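/- Assume the Setup: f ∈ R_9 satisfies (C1)–(C3), D is an irreducible homogeneous locally nilpotent derivation of R with D²(f) = 0, and g, h are homogeneous elements with ker D = k[g,h], d = deg g ≤ e = deg h. Then: (a) if r is a homogeneous minimal local slice for D, then Dr ∈ k[g] and there exist s, t ∈ k* such that f = s·h·r + t·g³; (b) (d,e) ∈ {(3,5), (3,7)}. -/

import Mathlib

open MvPolynomial

set_option synthInstance.maxHeartbeats 400000
set_option maxHeartbeats 1000000

noncomputable section

/-- The grading weights `(3, 2, 1)` for the variables `x = X 0`, `y = X 1`, `z = X 2`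
of `R = k[x,y,z]`. -/
def w3 : Fin 3 → ℕ := ![3, 2, 1]

/-- `D` is a locally nilpotent derivation: every element is killed by some power of `D`. -/
def IsLND {k B : Type*} [CommRing k] [CommRing B] [Algebra k B]
    (D : Derivation k B B) : Prop :=
  ∀ b : B, ∃ n : ℕ, (⇑D)^[n] b = 0

/-- A derivation `D` is irreducible if the only principal ideal of `B` containing the
image of `D` is `B` itself. -/
def IsIrreducibleDeriv {k B : Type*} [CommRing k] [CommRing B] [Algebra k B]
    (D : Derivation k B B) : Prop :=
  ∀ b : B, (∀ r : B, D r ∈ Ideal.span {b}) → IsUnit b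

/-- `D` is a homogeneous derivation of degree `m` with respect to the `ℕ`-grading of
`k[x,y,z]` in which the variables have weights `w`, i.e. `D(R_i) ⊆ R_{i+m}` for all `i`. -/
def DerivIsHomogOfDeg {k : Type} [Field k] (w : Fin 3 → ℕ)
    (D : Derivation k (MvPolynomial (Fin 3) k) (MvPolynomial (Fin 3) k)) (m : ℤ) : Prop :=
  ∀ (i : ℕ) (f : MvPolynomial (Fin 3) k), f.IsWeightedHomogeneous w i →
    (∀ j : ℕ, (j : ℤ) = (i : ℤ) + m → (D f).IsWeightedHomogeneous w j) ∧
    ((i : ℤ) + m < 0 → D f = 0)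

/-- `S` is a regular local ring: a Noetherian local ring whose maximal ideal (equivalently,
its Jacobson radical) can be generated by Krull-dimension many elements. -/
def IsRegLocalRing (S : Type*) [CommRing S] : Prop :=
  IsNoetherianRing S ∧ IsLocalRing S ∧
    ∃ s : Finset S, Ideal.span (s : Set S) = (⊥ : Ideal S).jacobson ∧
      (s.card : WithBot (WithTop ℕ)) = ringKrullDim S

/-- The scheme `Proj ℬ` has at least two singular points, i.e. two distinct points whose
local rings (the stalks of the structure sheaf) are not regular local rings. -/
def ProjHasTwoSingularPoints (k : Type) [Field k] {A : Type} [CommRing A] [Algebra k A]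
    (ℬ : ℕ → Submodule k A) [GradedAlgebra ℬ] : Prop :=
  ∃ x y : AlgebraicGeometry.Proj ℬ, x ≠ y ∧
    ¬ IsRegLocalRing ((AlgebraicGeometry.Proj ℬ).presheaf.stalk x) ∧
    ¬ IsRegLocalRing ((AlgebraicGeometry.Proj ℬ).presheaf.stalk y)

/-- Condition (C2): the projective curve `Proj (R/fR)` has at least two singular points.
Here the grading on `R/fR` is the (unique) `ℕ`-grading `ℬ` induced by the weighted grading of
`R = k[x,y,z]` with weights `(3,2,1)` via the quotient map. -/
def CondC2 (k : Type) [Field k] (f : MvPolynomial (Fin 3) k) : Prop :=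
  ∃ (ℬ : ℕ → Submodule k (MvPolynomial (Fin 3) k ⧸ Ideal.span {f}))
    (inst : GradedAlgebra ℬ),
    (∀ (i : ℕ) (r : MvPolynomial (Fin 3) k), r.IsWeightedHomogeneous w3 i →
      Ideal.Quotient.mk (Ideal.span {f}) r ∈ ℬ i) ∧
    @ProjHasTwoSingularPoints k _ _ _ _ ℬ inst

/-- Condition (C3): `f(x,y,0) = x (p x² + q y³)` for some `p, q ∈ k*`. -/
def CondC3 (k : Type) [Field k] (f : MvPolynomial (Fin 3) k) : Prop :=
  ∃ p q : k, p ≠ 0 ∧ q ≠ 0 ∧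
    aeval ![X 0, X 1, 0] f = X 0 * (C p * X 0 ^ 2 + C q * X 1 ^ 3)

/-- `r` is a local slice of `D`: `D r ≠ 0` and `D² r = 0`. -/
def IsLocalSlice {k B : Type*} [CommRing k] [CommRing B] [Algebra k B]
    (D : Derivation k B B) (r : B) : Prop :=
  D r ≠ 0 ∧ D (D r) = 0

/-- `r` is a minimal local slice of `D`: a local slice such that whenever
`(ker D)[r] ⊆ (ker D)[g]` for another local slice `g`, the two rings are equal. -/
def IsMinimalLocalSlice {k B : Type*} [CommRing k] [CommRing B] [Algebra k B]
    (D : Derivation k B B) (r : B) : Prop :=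
  IsLocalSlice D r ∧ ∀ g : B, IsLocalSlice D g →
    Algebra.adjoin k ({b : B | D b = 0} ∪ {r}) ≤ Algebra.adjoin k ({b : B | D b = 0} ∪ {g}) →
    Algebra.adjoin k ({b : B | D b = 0} ∪ {r}) = Algebra.adjoin k ({b : B | D b = 0} ∪ {g})

theorem reg_of_pid {T O : Type*} [CommRing T] [IsDomain T] [IsPrincipalIdealRing T]
    [CommRing O] [IsDomain O] [IsLocalRing O] (φ : T →+* O)
    (H : ∀ x, ∃ a b, φ b ≠ 0 ∧ φ b * x = φ a) : IsRegLocalRing O := by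
  classical
  have H2 : ∀ x, ∃ a b, IsUnit (φ b) ∧ φ b * x = φ a := by
    intro x
    obtain ⟨a, b, hb, hx⟩ := H x
    have hb0 : b ≠ 0 := by rintro rfl; simp at hb
    let _ := IsBezout.toGCDDomain T
    obtain ⟨d, a', b', hcop, ha, hb'⟩ : ∃ d a' b', IsCoprime a' b' ∧ a = d * a' ∧ b = d * b' := by
      refine ⟨gcd a b, ?_⟩
      obtain ⟨a', b', h1, h2, hc⟩ := extract_gcd a b
      exact ⟨a', b', (gcd_isUnit_iff _ _).1 hc, h1, h2⟩
    subst ha hb'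
    simp only [map_mul] at hx hb
    have hd : φ d ≠ 0 := left_ne_zero_of_mul hb
    have hx' : φ b' * x = φ a' := by
      apply mul_left_cancel₀ hd; rw [← hx]; ring
    obtain ⟨y, z, hyz⟩ := hcop
    refine ⟨a', b', ?_, hx'⟩
    apply IsUnit.of_mul_eq_one (φ y * x + φ z)
    have := congrArg φ hyz
    simp only [map_add, map_mul, map_one] at this
    rw [← this, ← hx']; ring
  have hP : IsPrincipalIdealRing O := by
    refine ⟨fun I => ?_⟩
    obtain ⟨t, ht⟩ := (IsPrincipalIdealRing.principal (I.comap φ)).principal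
    refine ⟨φ t, ?_⟩
    apply le_antisymm
    · intro x hx
      obtain ⟨a, b, hb, hab⟩ := H2 x
      have : a ∈ I.comap φ := by
        rw [Ideal.mem_comap, ← hab]; exact I.mul_mem_left _ hx
      rw [ht] at this
      obtain ⟨c, rfl⟩ := Submodule.mem_span_singleton.1 this
      obtain ⟨v, hv⟩ := hb
      refine Submodule.mem_span_singleton.2 ⟨(↑v⁻¹ : O) * φ c, ?_⟩
      have : (↑v⁻¹ : O) * (φ b * x) = x := by rw [← hv, ← mul_assoc, Units.inv_mul, one_mul]
      rw [← this, hab]; simp [mul_assoc]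
    · rw [Submodule.span_singleton_le_iff_mem]
      have : t ∈ I.comap φ := by rw [ht]; exact Submodule.mem_span_singleton_self t
      exact this
  refine ⟨inferInstance, inferInstance, ?_⟩
  rw [IsLocalRing.jacobson_eq_maximalIdeal ⊥ bot_ne_top]
  by_cases hF : IsField O
  · refine ⟨∅, ?_, ?_⟩
    · rw [IsLocalRing.isField_iff_maximalIdeal_eq.1 hF, Finset.coe_empty, Ideal.span_empty]
    · rw [ringKrullDim_eq_zero_of_isField hF]; simp; rfl
  · obtain ⟨t, ht⟩ := (hP.principal (IsLocalRing.maximalIdeal O)).principal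
    refine ⟨{t}, ?_, ?_⟩
    · rw [ht, Finset.coe_singleton]
    · rw [IsPrincipalIdealRing.ringKrullDim_eq_one O hF]; simp; rfl

set_option linter.unusedSectionVars false
section LND
variable {k B : Type*} [Field k] [CharZero k] [CommRing B] [IsDomain B] [Algebra k B]

theorem lnd_iter_zero (D : Derivation k B B) {x : B} {a c : ℕ} (h : (⇑D)^[a] x = 0) (hc : a ≤ c) :
    (⇑D)^[c] x = 0 := by
  obtain ⟨d, rfl⟩ := Nat.exists_eq_add_of_le hc
  rw [add_comm, Function.iterate_add_apply, h]
  exact Function.iterate_fixed (map_zero D) d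

theorem lnd_iter_add (D : Derivation k B B) (n : ℕ) (x y : B) :
    (⇑D)^[n] (x + y) = (⇑D)^[n] x + (⇑D)^[n] y := by
  induction n generalizing x y with
  | zero => rfl
  | succ n ih => simp only [Function.iterate_succ_apply, map_add, ih]

theorem lnd_iter_smul (D : Derivation k B B) (n : ℕ) (c : k) (x : B) :
    (⇑D)^[n] (c • x) = c • (⇑D)^[n] x := by
  induction n generalizing x with
  | zero => rfl
  | succ n ih => simp only [Function.iterate_succ_apply, Derivation.map_smul, ih]

theorem lnd_iter_ker_mul (D : Derivation k B B) (n : ℕ) {a : B} (ha : D a = 0) (x : B) :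
    (⇑D)^[n] (a * x) = a * (⇑D)^[n] x := by
  induction n generalizing x with
  | zero => rfl
  | succ n ih => simp only [Function.iterate_succ_apply, Derivation.leibniz, ha, ih, smul_eq_mul, mul_zero, add_zero]

theorem lnd_iter_mul (D : Derivation k B B) : ∀ (n a b : ℕ), a + b = n → ∀ (x y : B),
    (⇑D)^[a+1] x = 0 → (⇑D)^[b+1] y = 0 →
    (⇑D)^[n] (x * y) = (n.choose a : B) * ((⇑D)^[a] x * (⇑D)^[b] y) ∧
      (⇑D)^[n+1] (x * y) = 0 := by
  intro n
  induction n with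
  | zero =>
    intro a b hab x y hx hy
    obtain ⟨rfl, rfl⟩ : a = 0 ∧ b = 0 := by omega
    simp at hx hy
    simp [hx, hy]
  | succ n ih =>
    intro a b hab x y hx hy
    have e1 : (⇑D)^[n+1] (x * y) = (⇑D)^[n] (x * D y) + (⇑D)^[n] (D x * y) := by
      rw [Function.iterate_succ_apply, Derivation.leibniz, lnd_iter_add, smul_eq_mul, smul_eq_mul, mul_comm y]
    have e2 : (⇑D)^[n+1+1] (x * y) = (⇑D)^[n+1] (x * D y) + (⇑D)^[n+1] (D x * y) := by
      rw [Function.iterate_succ_apply, Derivation.leibniz, lnd_iter_add, smul_eq_mul, smul_eq_mul, mul_comm y]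
    rw [e1, e2]
    have Z : ∀ m, (⇑D)^[m] (0 : B) = 0 := fun m => Function.iterate_fixed (map_zero D) m
    rcases a with _ | a
    · have hx0 : D x = 0 := by simpa using hx
      obtain ⟨b, rfl⟩ : ∃ b', b = b' + 1 := ⟨n, by omega⟩
      obtain ⟨h1, h2⟩ := ih 0 b (by omega) x (D y) hx (by simpa [Function.iterate_succ_apply] using hy)
      rw [h1, h2, hx0]
      simp [Z]
    · rcases b with _ | b
      · have hy0 : D y = 0 := by simpa using hy
        obtain ⟨h1, h2⟩ := ih a 0 (by omega) (D x) y (by simpa [Function.iterate_succ_apply] using hx) hy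
        rw [h1, h2, hy0]
        have : n = a := by omega
        subst this
        simp [Z]
      · obtain ⟨h1, h2⟩ := ih (a+1) b (by omega) x (D y) hx (by simpa [Function.iterate_succ_apply] using hy)
        obtain ⟨h3, h4⟩ := ih a (b+1) (by omega) (D x) y (by simpa [Function.iterate_succ_apply] using hx) hy
        rw [h1, h2, h3, h4, Nat.choose_succ_succ]
        refine ⟨?_, by simp⟩
        simp only [← Function.iterate_succ_apply]
        push_cast
        ring

/-- exact degree -/
theorem lnd_exists_deg (D : Derivation k B B) (hD : IsLND D) {x : B} (hx : x ≠ 0) :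
    ∃ n, (⇑D)^[n] x ≠ 0 ∧ (⇑D)^[n+1] x = 0 := by
  classical
  have h := hD x
  have h0 : Nat.find h ≠ 0 := by
    intro h0
    have := Nat.find_spec h
    rw [h0] at this; exact hx this
  obtain ⟨n, hn⟩ := Nat.exists_eq_succ_of_ne_zero h0
  refine ⟨n, Nat.find_min h (by omega), ?_⟩
  have := Nat.find_spec h
  rwa [hn] at this

theorem charzero_alg (k : Type*) (B : Type*) [Field k] [CharZero k] [CommRing B] [IsDomain B] [Algebra k B] : CharZero B :=
  charZero_of_injective_algebraMap (algebraMap k B).injective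

theorem lnd_fact_closed (D : Derivation k B B) (hD : IsLND D) {x y : B} (hxy : x * y ≠ 0)
    (h : D (x * y) = 0) : D x = 0 := by
  have := charzero_alg k B
  obtain ⟨a, ha, ha'⟩ := lnd_exists_deg D hD (left_ne_zero_of_mul hxy)
  obtain ⟨b, hb, hb'⟩ := lnd_exists_deg D hD (right_ne_zero_of_mul hxy)
  have := (lnd_iter_mul D (a+b) a b rfl x y ha' hb').1
  rcases a with _ | a
  · simpa using ha'
  · exfalso
    rw [lnd_iter_zero D (a := 1) (by simpa using h) (by omega)] at this
    have hc : ((a + 1 + b).choose (a+1) : B) ≠ 0 := by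
      exact_mod_cast (Nat.choose_pos (by omega)).ne'
    exact (mul_ne_zero hc (mul_ne_zero ha hb)) this.symm

theorem lnd_iter_pow (D : Derivation k B B) {s : B} (hs : D (D s) = 0) (N : ℕ) :
    (⇑D)^[N] (s ^ N) = (N.factorial : B) * (D s) ^ N ∧ (⇑D)^[N+1] (s ^ N) = 0 := by
  induction N with
  | zero => simp
  | succ N ih =>
    have := lnd_iter_mul D (N+1) N 1 rfl (s ^ N) s ih.2 (by simpa using hs)
    rw [pow_succ]
    refine ⟨?_, this.2⟩
    rw [this.1, ih.1, Nat.factorial_succ]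
    simp; ring

/-- the reduction step: `N! a^N e - (δ^N e) s^N` has lower degree. -/
theorem lnd_reduce (D : Derivation k B B) {s : B} (hs : D (D s) = 0) (N : ℕ) {e : B}
    (he : (⇑D)^[N+1] e = 0) :
    (⇑D)^[N] ((N.factorial : B) * (D s) ^ N * e - (⇑D)^[N] e * s ^ N) = 0 := by
  have h1 : D ((N.factorial : B) * (D s) ^ N) = 0 := by
    simp [Derivation.leibniz, Derivation.leibniz_pow, hs]
  have h2 : D ((⇑D)^[N] e) = 0 := by have := he; rwa [Function.iterate_succ_apply'] at this
  rw [sub_eq_add_neg, lnd_iter_add, lnd_iter_ker_mul D N h1, ← neg_one_smul k, lnd_iter_smul, lnd_iter_ker_mul D N h2,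
    (lnd_iter_pow D hs N).1]
  simp; ring

end LND

theorem exists_dom_val {B : Type} [CommRing B] [IsDomain B] (P : Ideal B) [P.IsPrime] :
    ∃ (Γ : Type) (_ : LinearOrderedCommGroupWithZero Γ) (v : Valuation B Γ),
      (∀ b, v b = 0 → b = 0) ∧ (∀ b, v b ≤ 1) ∧ (∀ b, v b < 1 ↔ b ∈ P) := by
  let K := FractionRing B
  have hunit : ∀ y : P.primeCompl, IsUnit (algebraMap B K y) := by
    intro y
    apply IsUnit.mk0
    intro h
    have : (y : B) = 0 := (IsFractionRing.injective B K) (by rw [h, map_zero])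
    exact y.2 (by rw [this]; exact P.zero_mem)
  let F : Localization.AtPrime P →+* K := IsLocalization.lift hunit
  have hF : ∀ b, F (algebraMap B _ b) = algebraMap B K b := fun b => IsLocalization.lift_eq hunit b
  obtain ⟨A, h, hl⟩ := IsLocalRing.exists_factor_valuationRing F
  refine ⟨A.ValueGroup, inferInstance, A.valuation.comap (algebraMap B K), ?_, ?_, ?_⟩
  · intro b hb
    rw [Valuation.comap_apply, Valuation.zero_iff] at hb
    exact (IsFractionRing.injective B K) (by rw [hb, map_zero])
  · intro b
    rw [Valuation.comap_apply, A.valuation_le_one_iff, ← hF]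
    exact h _
  · intro b
    have hb : algebraMap B K b ∈ A := by rw [← hF]; exact h _
    have e : (⟨algebraMap B K b, hb⟩ : A) = F.codRestrict A.toSubring h (algebraMap B _ b) := by
      ext; exact (hF b).symm
    rw [Valuation.comap_apply]
    have h1 := A.valuation_lt_one_iff ⟨algebraMap B K b, hb⟩
    have h2 : (⟨algebraMap B K b, hb⟩ : A) ∈ IsLocalRing.maximalIdeal A ↔ ¬ IsUnit (⟨algebraMap B K b, hb⟩ : A) := by
      simp
    have h3 : IsUnit (⟨algebraMap B K b, hb⟩ : A) ↔ IsUnit (algebraMap B (Localization.AtPrime P) b) := by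
      rw [e]
      exact isUnit_map_iff (F.codRestrict A.toSubring h) _
    have h4 := IsLocalization.AtPrime.isUnit_to_map_iff (Localization.AtPrime P) P b
    rw [← h1, h2, h3, h4]
    simp [Ideal.primeCompl]

structure GrSetup (k : Type*) {B : Type*} [Field k] [CommRing B] [Algebra k B]
    (H : ℕ → Submodule k B) (δ : Derivation k B B) (m : ℤ) : Prop where
  one : (1 : B) ∈ H 0
  mul : ∀ {i j a b}, a ∈ H i → b ∈ H j → a * b ∈ H (i + j)
  hom : ∀ i a, a ∈ H i → (∀ j : ℕ, (j : ℤ) = i + m → δ a ∈ H j) ∧ ((i : ℤ) + m < 0 → δ a = 0)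
  lnd : IsLND δ
  prop : ∀ i a b, a ∈ H i → b ∈ H i → δ a = 0 → δ b = 0 → b ≠ 0 → ∃ c : k, a = c • b

section Uniq
variable {k B : Type*} [Field k] [CharZero k] [CommRing B] [IsDomain B] [Algebra k B]
  {H : ℕ → Submodule k B} {δ : Derivation k B B} {m : ℤ}

theorem GrSetup.pow (S : GrSetup k H δ m) {i a} (ha : a ∈ H i) (n : ℕ) : a ^ n ∈ H (n * i) := by
  induction n with
  | zero => simpa using S.one
  | succ n ih => rw [pow_succ, Nat.succ_mul]; exact S.mul ih ha

theorem iter_hom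
    (hom : ∀ i a, a ∈ H i → (∀ j : ℕ, (j : ℤ) = i + m → δ a ∈ H j) ∧ ((i : ℤ) + m < 0 → δ a = 0))
    {i a} (ha : a ∈ H i) (N : ℕ) (hN : (⇑δ)^[N] a ≠ 0) :
    ∃ j : ℕ, (j : ℤ) = i + N * m ∧ (⇑δ)^[N] a ∈ H j := by
  induction N with
  | zero => exact ⟨i, by simp, ha⟩
  | succ N ih =>
    rw [Function.iterate_succ_apply'] at hN ⊢
    have h0 : (⇑δ)^[N] a ≠ 0 := by intro h; rw [h, map_zero] at hN; exact hN rfl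
    obtain ⟨j, hj, hm⟩ := ih h0
    obtain ⟨h1, h2⟩ := hom j _ hm
    have : 0 ≤ (j : ℤ) + m := by
      by_contra hc
      exact hN (h2 (by omega))
    obtain ⟨l, hl⟩ := Int.eq_ofNat_of_zero_le this
    refine ⟨l, ?_, h1 l (by omega)⟩
    rw [← hl, hj]; push_cast; ring

variable {Γ : Type*} [LinearOrderedCommGroupWithZero Γ]

theorem val_const (v : Valuation B Γ) (hv1 : ∀ b, v b ≤ 1) {c : k} (hc : c ≠ 0) :
    v (algebraMap k B c) = 1 := by
  apply le_antisymm (hv1 _)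
  have h1 : v (algebraMap k B c) * v (algebraMap k B c⁻¹) = 1 := by
    rw [← map_mul, ← map_mul, mul_inv_cancel₀ hc, map_one, map_one]
  calc (1 : Γ) = v (algebraMap k B c) * v (algebraMap k B c⁻¹) := h1.symm
    _ ≤ v (algebraMap k B c) * 1 := by gcongr; exact hv1 _
    _ = _ := mul_one _

theorem val_ker (S : GrSetup k H δ m) (v : Valuation B Γ) (hv1 : ∀ b, v b ≤ 1)
    {u : B} {n : ℕ} (hu : u ∈ H n) (hu0 : u ≠ 0) (hδu : δ u = 0)
    {a : B} {i : ℕ} (ha : a ∈ H i) (ha0 : a ≠ 0) (hδa : δ a = 0) : v a ^ n = v u ^ i := by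
  have h1 := S.pow ha n
  have h2 := S.pow hu i
  rw [mul_comm] at h2
  obtain ⟨c, hc⟩ := S.prop _ _ _ h1 h2 (by simp [Derivation.leibniz_pow, hδa])
    (by simp [Derivation.leibniz_pow, hδu]) (pow_ne_zero _ hu0)
  have hc0 : c ≠ 0 := by
    rintro rfl
    rw [zero_smul] at hc
    exact pow_ne_zero n ha0 hc
  rw [← map_pow, hc, Algebra.smul_def, map_mul, val_const v hv1 hc0, one_mul, map_pow]

/-- common data of the reduction step -/
theorem val_step (S : GrSetup k H δ m) (v : Valuation B Γ) (hv0 : ∀ b, v b = 0 → b = 0)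
    (hv1 : ∀ b, v b ≤ 1)
    {u : B} {n : ℕ} (hu : u ∈ H n) (hu0 : u ≠ 0) (hδu : δ u = 0)
    {s : B} {ds : ℕ} (hs : s ∈ H ds) (hs1 : δ s ≠ 0) (hs2 : δ (δ s) = 0)
    {Y : Γ} (hY : v s ^ n = Y * v u ^ ds)
    (N : ℕ) {e : B} {i : ℕ} (he : e ∈ H i) (h1 : (⇑δ)^[N] e ≠ 0) (h2 : (⇑δ)^[N+1] e = 0) :
    ∃ (E T e' : B) (M M' : ℕ), E = T + e' ∧ M = M' + i ∧ e' ∈ H M ∧ (⇑δ)^[N] e' = 0 ∧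
      v E ^ n = v u ^ M' * v e ^ n ∧ v T ^ n = Y ^ N * v u ^ M := by
  have hcz := charzero_alg k B
  obtain ⟨jα, hjα, hα⟩ := iter_hom S.hom he N h1
  obtain ⟨ja, hja, ha⟩ := iter_hom S.hom hs 1 hs1
  rw [Function.iterate_one] at ha
  have hδα : δ ((⇑δ)^[N] e) = 0 := by have := h2; rwa [Function.iterate_succ_apply'] at this
  have hM : jα + N * ds = N * ja + i := by
    zify; rw [hjα, hja]; push_cast; ring
  have hT : (⇑δ)^[N] e * s ^ N ∈ H (N * ja + i) := hM ▸ S.mul hα (S.pow hs N)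
  have hE : (N.factorial : B) * (δ s) ^ N * e ∈ H (N * ja + i) := by
    have h0 : (δ s) ^ N * e ∈ H (N * ja + i) := S.mul (S.pow ha N) he
    have := (H (N * ja + i)).smul_mem (N.factorial : k) h0
    rwa [Algebra.smul_def, map_natCast, ← mul_assoc] at this
  refine ⟨(N.factorial : B) * (δ s) ^ N * e, (⇑δ)^[N] e * s ^ N, 
    (N.factorial : B) * (δ s) ^ N * e - (⇑δ)^[N] e * s ^ N, N * ja + i, N * ja, by ring, rfl,
    Submodule.sub_mem _ hE hT, lnd_reduce δ hs2 N h2, ?_, ?_⟩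
  · have hf : v (N.factorial : B) = 1 := by
      have := val_const (k := k) v hv1 (c := (N.factorial : k)) (by exact_mod_cast N.factorial_ne_zero)
      rwa [map_natCast] at this
    have := val_ker S v hv1 hu hu0 hδu ha hs1 hs2
    rw [map_mul, map_mul, hf, one_mul, map_pow, mul_pow, ← pow_mul, mul_comm N n, pow_mul, this, ← pow_mul, mul_comm ja N]
  · have := val_ker S v hv1 hu hu0 hδu hα h1 hδα
    rw [map_mul, mul_pow, this, map_pow, ← pow_mul, mul_comm N n, pow_mul, hY, mul_pow, ← hM, ← pow_mul, pow_add,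
      mul_comm ds N]
    simp only [mul_comm, mul_left_comm]

theorem val_formula (S : GrSetup k H δ m) (v : Valuation B Γ) (hv0 : ∀ b, v b = 0 → b = 0)
    (hv1 : ∀ b, v b ≤ 1)
    {u : B} {n : ℕ} (hn : n ≠ 0) (hu : u ∈ H n) (hu0 : u ≠ 0) (hδu : δ u = 0)
    {s : B} {ds : ℕ} (hs : s ∈ H ds) (hs1 : δ s ≠ 0) (hs2 : δ (δ s) = 0)
    {Y : Γ} (hY : v s ^ n = Y * v u ^ ds) (hY1 : 1 < Y) :
    ∀ (N : ℕ) {e : B} {i : ℕ}, e ∈ H i → (⇑δ)^[N] e ≠ 0 → (⇑δ)^[N+1] e = 0 →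
      v e ^ n = Y ^ N * v u ^ i := by
  intro N
  induction N using Nat.strong_induction_on with
  | _ N ih =>
  intro e i he h1 h2
  obtain ⟨E, T, e', M, M', hE, hM, he', hδe', hvE, hvT⟩ :=
    val_step S v hv0 hv1 hu hu0 hδu hs hs1 hs2 hY N he h1 h2
  have hvu : v u ≠ 0 := fun h => hu0 (hv0 _ h)
  have hET : v E = v T := by
    by_cases h0 : e' = 0
    · rw [hE, h0, add_zero]
    · obtain ⟨N', hN1, hN2⟩ := lnd_exists_deg δ S.lnd h0
      have hlt : N' < N := by
        by_contra hc
        exact hN1 (lnd_iter_zero δ hδe' (by omega))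
      have := ih N' hlt he' hN1 hN2
      have hlt2 : v e' ^ n < v T ^ n := by
        rw [this, hvT]
        have h3 : Y ^ N' < Y ^ N := pow_lt_pow_right₀ hY1 hlt
        exact mul_lt_mul_of_pos_right h3 (zero_lt_iff.2 (pow_ne_zero _ hvu))
      have : v e' < v T := lt_of_pow_lt_pow_left₀ n zero_le hlt2
      rw [hE]
      exact Valuation.map_add_eq_of_lt_left v this
  have h5 : v u ^ M' * v e ^ n = v u ^ M' * (Y ^ N * v u ^ i) := by
    rw [← hvE, hET, hvT, hM, pow_add]; 
    simp only [mul_comm, mul_left_comm, mul_assoc]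
  exact mul_left_cancel₀ (pow_ne_zero _ hvu) h5

theorem val_bound (S : GrSetup k H δ m) (v : Valuation B Γ) (hv0 : ∀ b, v b = 0 → b = 0)
    (hv1 : ∀ b, v b ≤ 1)
    {u : B} {n : ℕ} (hn : n ≠ 0) (hu : u ∈ H n) (hu0 : u ≠ 0) (hδu : δ u = 0)
    {s : B} {ds : ℕ} (hs : s ∈ H ds) (hs1 : δ s ≠ 0) (hs2 : δ (δ s) = 0)
    {Y : Γ} (hY : v s ^ n = Y * v u ^ ds) (hY1 : Y ≤ 1) :
    ∀ (N : ℕ) {e : B} {i : ℕ}, e ∈ H i → (⇑δ)^[N] e = 0 → 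
      v e ^ n ≤ v u ^ i := by
  intro N
  induction N with
  | zero => 
    intro e i he h1
    have : e = 0 := h1
    rw [this, map_zero, zero_pow hn]; exact zero_le
  | succ N ih =>
  intro e i he h2
  by_cases h1 : (⇑δ)^[N] e = 0
  · exact ih he h1
  obtain ⟨E, T, e', M, M', hE, hM, he', hδe', hvE, hvT⟩ :=
    val_step S v hv0 hv1 hu hu0 hδu hs hs1 hs2 hY N he h1 h2
  have hvu : v u ≠ 0 := fun h => hu0 (hv0 _ h)
  have hT : v T ^ n ≤ v u ^ M := by
    rw [hvT]
    calc _ ≤ 1 * v u ^ M := by gcongr; exact pow_le_one₀ zero_le hY1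
      _ = _ := one_mul _
  have hE2 : v E ^ n ≤ v u ^ M := by
    rw [hE]
    rcases le_total (v T) (v e') with h | h
    · calc v (T + e') ^ n ≤ v e' ^ n := by gcongr; exact (v.map_add _ _).trans (max_le h le_rfl)
        _ ≤ _ := ih he' hδe'
    · calc v (T + e') ^ n ≤ v T ^ n := by gcongr; exact (v.map_add _ _).trans (max_le le_rfl h)
        _ ≤ _ := hT
  rw [hvE, hM, pow_add] at hE2
  exact le_of_mul_le_mul_left hE2 (zero_lt_iff.2 (pow_ne_zero _ hvu))

end Uniq

theorem uniq_core {k B : Type} [Field k] [CharZero k] [CommRing B] [IsDomain B] [Algebra k B]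
    {H : ℕ → Submodule k B} {δ : Derivation k B B} {m : ℤ}
    (S : GrSetup k H δ m)
    {u : B} {n : ℕ} (hn : n ≠ 0) (hu : u ∈ H n) (hu0 : u ≠ 0) (hδu : δ u = 0)
    {s : B} {ds : ℕ} (hs : s ∈ H ds) (hs1 : δ s ≠ 0) (hs2 : δ (δ s) = 0)
    (P P' : Ideal B) [P.IsPrime] [P'.IsPrime] (huP : u ∈ P) (huP' : u ∈ P')
    {b c : B} {i j : ℕ} (hi : i ≠ 0) (hj : j ≠ 0) (hc : c ∈ H i) (hb : b ∈ H j)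
    (hbP' : b ∉ P') (hcP' : c ∈ P') : c ∈ P := by
  by_contra hcP
  obtain ⟨Γ, _, v, hv0, hv1, hv⟩ := exists_dom_val P
  obtain ⟨Γ', _, v', hv0', hv1', hv'⟩ := exists_dom_val P'
  have hvu : v u ≠ 0 := fun h => hu0 (hv0 _ h)
  have hvu' : v' u ≠ 0 := fun h => hu0 (hv0' _ h)
  have hc0 : c ≠ 0 := by rintro rfl; exact hcP P.zero_mem
  have hb0 : b ≠ 0 := by rintro rfl; exact hbP' P'.zero_mem
  have hvc : v c = 1 := le_antisymm (hv1 c) (not_lt.1 fun h => hcP ((hv c).1 h))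
  have hvb' : v' b = 1 := le_antisymm (hv1' b) (not_lt.1 fun h => hbP' ((hv' b).1 h))
  have hvu1 : v u < 1 := (hv u).2 huP
  have hvu1' : v' u < 1 := (hv' u).2 huP'
  obtain ⟨Y, hY⟩ : ∃ Y, v s ^ n = Y * v u ^ ds := ⟨v s ^ n / v u ^ ds, by
    rw [div_mul_cancel₀ _ (pow_ne_zero _ hvu)]⟩
  obtain ⟨Y', hY'⟩ : ∃ Y, v' s ^ n = Y * v' u ^ ds := ⟨v' s ^ n / v' u ^ ds, by
    rw [div_mul_cancel₀ _ (pow_ne_zero _ hvu')]⟩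
  have hY1 : 1 < Y := by
    by_contra h
    obtain ⟨N, hN⟩ := S.lnd c
    have := val_bound S v hv0 hv1 hn hu hu0 hδu hs hs1 hs2 hY (not_lt.1 h) N hc hN
    rw [hvc, one_pow] at this
    exact absurd (pow_lt_one₀ zero_le hvu1 hi) (not_lt.2 this)
  have hY1' : 1 < Y' := by
    by_contra h
    obtain ⟨N, hN⟩ := S.lnd b
    have := val_bound S v' hv0' hv1' hn hu hu0 hδu hs hs1 hs2 hY' (not_lt.1 h) N hb hN
    rw [hvb', one_pow] at this
    exact absurd (pow_lt_one₀ zero_le hvu1' hj) (not_lt.2 this)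
  obtain ⟨Nc, c1, c2⟩ := lnd_exists_deg δ S.lnd hc0
  obtain ⟨Nb, b1, b2⟩ := lnd_exists_deg δ S.lnd hb0
  have k1 := val_formula S v hv0 hv1 hn hu hu0 hδu hs hs1 hs2 hY hY1 Nc hc c1 c2
  have k2 := val_formula S v hv0 hv1 hn hu hu0 hδu hs hs1 hs2 hY hY1 Nb hb b1 b2
  have k3 := val_formula S v' hv0' hv1' hn hu hu0 hδu hs hs1 hs2 hY' hY1' Nc hc c1 c2
  have k4 := val_formula S v' hv0' hv1' hn hu hu0 hδu hs hs1 hs2 hY' hY1' Nb hb b1 b2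
  rw [hvc, one_pow] at k1
  rw [hvb', one_pow] at k4
  have k2' : Y ^ Nb * v u ^ j ≤ 1 := by rw [← k2]; exact pow_le_one₀ zero_le (hv1 b)
  have k3' : Y' ^ Nc * v' u ^ i < 1 := by
    rw [← k3]; exact pow_lt_one₀ zero_le ((hv' c).2 hcP') hn
  have l1 : Y ^ (Nb * i) ≤ Y ^ (Nc * j) := by
    have a1 : Y ^ (Nc * j) * v u ^ (i * j) = 1 := by
      rw [pow_mul, pow_mul, ← mul_pow, ← k1, one_pow]
    have a2 : Y ^ (Nb * i) * v u ^ (i * j) ≤ 1 := by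
      rw [mul_comm i j, pow_mul, pow_mul, ← mul_pow]; exact pow_le_one₀ zero_le k2'
    rw [← a1] at a2
    exact le_of_mul_le_mul_right a2 (zero_lt_iff.2 (pow_ne_zero _ hvu))
  have l2 : Y' ^ (Nc * j) < Y' ^ (Nb * i) := by
    have a1 : Y' ^ (Nb * i) * v' u ^ (i * j) = 1 := by
      rw [mul_comm i j, pow_mul, pow_mul, ← mul_pow, ← k4, one_pow]
    have a2 : Y' ^ (Nc * j) * v' u ^ (i * j) < 1 := by
      rw [pow_mul, pow_mul, ← mul_pow]; exact pow_lt_one₀ zero_le k3' hj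
    rw [← a1] at a2
    exact lt_of_mul_lt_mul_right a2 zero_le
  have m1 := (pow_le_pow_iff_right₀ hY1).1 l1
  have m2 := (pow_lt_pow_iff_right₀ hY1').1 l2
  omega

section RegField
variable {k B : Type*} [Field k] [CommRing B] [IsDomain B] [Algebra k B]

/-- the graded span -/
def grS (k : Type*) {B : Type*} [Field k] [CommRing B] [Algebra k B]
    (KK : ℕ → Set B) (s : B) (ds : ℕ) (i : ℕ) : Submodule k B :=
  Submodule.span k {x | ∃ a l j, a ∈ KK l ∧ l + j * ds = i ∧ x = a * s ^ j}

theorem grS_mul (KK : ℕ → Set B) (hmul : ∀ {i j a b}, a ∈ KK i → b ∈ KK j → a * b ∈ KK (i + j))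
    (s : B) (ds : ℕ) {i j : ℕ} {x y : B} (hx : x ∈ grS k KK s ds i) (hy : y ∈ grS k KK s ds j) :
    x * y ∈ grS k KK s ds (i + j) := by
  have h := Submodule.mul_mem_mul hx hy
  rw [grS, grS, Submodule.span_mul_span] at h
  refine Submodule.span_mono ?_ h
  rintro _ ⟨_, ⟨a, l, p, ha, h1, rfl⟩, _, ⟨b, l', p', hb, h1', rfl⟩, rfl⟩
  refine ⟨a * b, l + l', p + p', hmul ha hb, by rw [← h1, ← h1']; ring, by simp only; ring⟩

theorem grS_pow (KK : ℕ → Set B) (hone : (1 : B) ∈ KK 0)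
    (hmul : ∀ {i j a b}, a ∈ KK i → b ∈ KK j → a * b ∈ KK (i + j))
    (s : B) (ds : ℕ) {i : ℕ} {x : B} (hx : x ∈ grS k KK s ds i) (n : ℕ) :
    x ^ n ∈ grS k KK s ds (n * i) := by
  induction n with
  | zero => exact Submodule.subset_span ⟨1, 0, 0, hone, by simp, by simp⟩
  | succ n ih => rw [pow_succ, Nat.succ_mul]; exact grS_mul KK hmul s ds ih hx

theorem KK_pow (KK : ℕ → Set B) (hone : (1 : B) ∈ KK 0)
    (hmul : ∀ {i j a b}, a ∈ KK i → b ∈ KK j → a * b ∈ KK (i + j))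
    {i : ℕ} {x : B} (hx : x ∈ KK i) (n : ℕ) :
    x ^ n ∈ KK (n * i) := by
  induction n with
  | zero => simpa using hone
  | succ n ih => rw [pow_succ, Nat.succ_mul]; exact hmul ih hx

theorem reg_field (H : ℕ → Submodule k B) 
    (Hone : (1 : B) ∈ H 0) (Hmul : ∀ {i j a b}, a ∈ H i → b ∈ H j → a * b ∈ H (i + j))
    (KK : ℕ → Set B) (hKH : ∀ l a, a ∈ KK l → a ∈ H l)
    (hone : (1 : B) ∈ KK 0)
    (hmul : ∀ {i j a b}, a ∈ KK i → b ∈ KK j → a * b ∈ KK (i + j))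
    (hprop : ∀ i a b, a ∈ KK i → b ∈ KK i → b ≠ 0 → ∃ c : k, a = c • b)
    {u : B} {n : ℕ} (hn : n ≠ 0) (hu : u ∈ KK n) (hu0 : u ≠ 0)
    {s : B} {ds : ℕ} (hs : s ∈ H ds) (hs0 : s ≠ 0)
    (hfrac : ∀ i e, e ∈ H i → ∃ j c, c ≠ 0 ∧ c ∈ grS k KK s ds j ∧ c * e ∈ grS k KK s ds (i + j))
    (K : Type*) [Field K] [Algebra k K] [Algebra B K] [IsScalarTower k B K] [FaithfulSMul B K] :
    ∃ (q : ℕ) (w : B), w ∈ H (q * n) ∧ ∀ i x y, x ∈ H i → y ∈ H i → y ≠ 0 → ∃ p r : Polynomial k,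
      Polynomial.aeval (algebraMap B K w / algebraMap B K (u ^ q)) r ≠ 0 ∧
      Polynomial.aeval (algebraMap B K w / algebraMap B K (u ^ q)) r * algebraMap B K x =
      Polynomial.aeval (algebraMap B K w / algebraMap B K (u ^ q)) p * algebraMap B K y := by
  classical
  have inj : Function.Injective (algebraMap B K) := FaithfulSMul.algebraMap_injective B K
  have Hpow : ∀ {i x}, x ∈ H i → ∀ m : ℕ, x ^ m ∈ H (m * i) := by
    intro i x hx m
    induction m with
    | zero => simpa using Hone
    | succ m ih => rw [pow_succ, Nat.succ_mul]; exact Hmul ih hx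
  have hex : ∃ i, 0 < i ∧ ∃ l a, a ∈ KK l ∧ a ≠ 0 ∧ ∃ q, l + i * ds = q * n :=
    ⟨n, Nat.pos_of_ne_zero hn, 0, 1, hone, one_ne_zero, ds, by ring⟩
  obtain ⟨hpos, l, a0, ha0, ha00, q, hq⟩ := Nat.find_spec hex
  have hmin : ∀ i, 0 < i → i < Nat.find hex → ¬ ∃ l a, a ∈ KK l ∧ a ≠ 0 ∧ ∃ q, l + i * ds = q * n :=
    fun i h1 h2 h3 => Nat.find_min hex h2 ⟨h1, h3⟩
  generalize Nat.find hex = i0 at *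
  refine ⟨q, a0 * s ^ i0, ?_, ?_⟩
  · rw [← hq]; exact Hmul (hKH _ _ ha0) (Hpow hs _)
  have hU : algebraMap B K u ≠ 0 := by rwa [Ne, map_eq_zero_iff _ inj]
  set v : K := algebraMap B K (a0 * s ^ i0) / algebraMap B K (u ^ q) with hv
  have hv' : v * algebraMap B K u ^ q = algebraMap B K a0 * algebraMap B K s ^ i0 := by
    rw [hv, map_pow, div_mul_cancel₀ _ (pow_ne_zero _ hU), map_mul, map_pow]
  -- monomials
  have mono : ∀ l' a j q', a ∈ KK l' → l' + j * ds = q' * n →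
      ∃ p : Polynomial k, algebraMap B K (a * s ^ j) = Polynomial.aeval v p * algebraMap B K u ^ q' := by
    intro l' a j q' ha hq'
    by_cases haz : a = 0
    · exact ⟨0, by simp [haz]⟩
    have hmod : j % i0 = 0 := by
      by_contra hne
      apply hmin (j % i0) (Nat.pos_of_ne_zero hne) (Nat.mod_lt _ hpos)
      obtain ⟨n', rfl⟩ := Nat.exists_eq_succ_of_ne_zero hn
      refine ⟨l' + (n' * (j / i0)) * l, a * a0 ^ (n' * (j / i0)), hmul ha (KK_pow KK hone hmul ha0 _),
        mul_ne_zero haz (pow_ne_zero _ ha00), ?_⟩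
      have hj := Nat.div_add_mod j i0
      generalize j / i0 = c at *
      generalize j % i0 = r at *
      have hdvd : ((n' + 1 : ℕ) : ℤ) ∣ ((l' + n' * c * l + r * ds : ℕ) : ℤ) := by
        refine ⟨q' + c * l - c * q, ?_⟩
        have e1 : (l' : ℤ) + j * ds = q' * (n' + 1) := by exact_mod_cast hq'
        have e2 : (l : ℤ) + i0 * ds = q * (n' + 1) := by exact_mod_cast hq
        have e3 : (i0 : ℤ) * c + r = j := by exact_mod_cast hj
        push_cast
        rw [← e3] at e1
        linear_combination e1 - c * e2
      obtain ⟨t, ht⟩ := Int.natCast_dvd_natCast.1 hdvd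
      exact ⟨t, by rw [ht, Nat.succ_eq_add_one]; ring⟩
    obtain ⟨c, rfl⟩ := Nat.dvd_of_mod_eq_zero hmod
    have d1 : a * u ^ (q * c) ∈ KK (l' + q * c * n) := hmul ha (KK_pow KK hone hmul hu _)
    have d2 : a0 ^ c * u ^ q' ∈ KK (l' + q * c * n) := by
      have : l' + q * c * n = c * l + q' * n := by
        rw [← hq']
        have : q * c * n = c * (q * n) := by ring
        rw [this, ← hq]; ring
      rw [this]
      exact hmul (KK_pow KK hone hmul ha0 _) (KK_pow KK hone hmul hu _)
    obtain ⟨lam, hlam⟩ := hprop _ _ _ d1 d2 (mul_ne_zero (pow_ne_zero _ ha00) (pow_ne_zero _ hu0))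
    refine ⟨Polynomial.C lam * Polynomial.X ^ c, ?_⟩
    have h1 := congrArg (algebraMap B K) hlam
    rw [Algebra.smul_def, ] at h1
    simp only [map_mul, map_pow, ← IsScalarTower.algebraMap_apply] at h1
    apply mul_right_cancel₀ (pow_ne_zero (q * c) hU)
    simp only [map_mul, map_pow, Polynomial.aeval_C, Polynomial.aeval_X]
    calc _ = (algebraMap B K a * algebraMap B K u ^ (q * c)) * algebraMap B K s ^ (i0 * c) := by ring
      _ = algebraMap k K lam * (algebraMap B K a0 * algebraMap B K s ^ i0) ^ c * algebraMap B K u ^ q' := by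
        rw [h1]; ring
      _ = _ := by rw [← hv']; ring
  have span : ∀ q' x, x ∈ grS k KK s ds (q' * n) →
      ∃ p : Polynomial k, algebraMap B K x = Polynomial.aeval v p * algebraMap B K u ^ q' := by
    intro q' x hx
    refine Submodule.span_induction ?_ ?_ ?_ ?_ hx
    · rintro _ ⟨a, l', j, ha, hl, rfl⟩
      exact mono l' a j q' ha hl
    · exact ⟨0, by simp⟩
    · rintro x y _ _ ⟨p, hp⟩ ⟨p', hp'⟩
      exact ⟨p + p', by rw [map_add, hp, hp', map_add]; ring⟩
    · rintro c x _ ⟨p, hp⟩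
      refine ⟨Polynomial.C c * p, ?_⟩
      rw [Algebra.smul_def, map_mul, hp, ← IsScalarTower.algebraMap_apply]; simp [mul_assoc]
  intro i x y hx hy hy0
  obtain ⟨n', rfl⟩ := Nat.exists_eq_succ_of_ne_zero hn
  have hE : x * y ^ n' ∈ H ((n' + 1) * i) := by
    have := Hmul hx (Hpow hy n'); rwa [show i + n' * i = (n' + 1) * i by ring] at this
  have hF : y ^ (n' + 1) ∈ H ((n' + 1) * i) := Hpow hy _
  obtain ⟨j, c, hc0, hc, hcE⟩ := hfrac _ _ hE
  obtain ⟨j', c', hc0', hc', hcF⟩ := hfrac _ _ hF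
  have key : ∀ {z : B} {c c' : B} {j j'}, c ∈ grS k KK s ds j → c' ∈ grS k KK s ds j' → 
      c * z ∈ grS k KK s ds ((n' + 1) * i + j) → 
      c ^ (n' + 1) * c' ^ (n' + 1) * z ∈ grS k KK s ds ((i + j + j') * (n' + 1)) := by
    intro z c c' j j' h1 h2 h3
    have a1 := grS_mul KK hmul s ds (grS_mul KK hmul s ds (grS_pow KK hone hmul s ds h1 n')
      (grS_pow KK hone hmul s ds h2 (n' + 1))) h3
    convert a1 using 1
    · congr 1; ring
    · ring
  have kE := key hc hc' hcE
  have kF := key hc' hc hcF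
  rw [show i + j' + j = i + j + j' by ring, mul_comm (c' ^ _)] at kF
  obtain ⟨p, hp⟩ := span _ _ kE
  obtain ⟨r, hr⟩ := span _ _ kF
  have hcc : c ^ (n' + 1) * c' ^ (n' + 1) ≠ 0 := mul_ne_zero (pow_ne_zero _ hc0) (pow_ne_zero _ hc0')
  generalize c ^ (n' + 1) * c' ^ (n' + 1) = cc at *
  refine ⟨p, r, ?_, ?_⟩
  · intro h0
    rw [h0, zero_mul, map_eq_zero_iff _ inj] at hr
    exact mul_ne_zero hcc (pow_ne_zero _ hy0) hr
  · have hY : algebraMap B K y ≠ 0 := by rwa [Ne, map_eq_zero_iff _ inj]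
    apply mul_right_cancel₀ (pow_ne_zero (i + j + j') hU)
    apply mul_right_cancel₀ (pow_ne_zero n' hY)
    calc _ = (Polynomial.aeval v r * algebraMap B K u ^ (i + j + j')) * algebraMap B K x * algebraMap B K y ^ n' := by ring
      _ = (algebraMap B K (cc * (x * y ^ n'))) * algebraMap B K y ^ (n' + 1) := by
        rw [← hr]; simp only [map_mul, map_pow]; ring
      _ = _ := by rw [hp]; ring
end RegField

theorem IsRegLocalRing.of_equiv {S T : Type*} [CommRing S] [CommRing T] (e : S ≃+* T)
    (h : IsRegLocalRing T) : IsRegLocalRing S := by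
  classical
  obtain ⟨h1, h2, s, hs, hc⟩ := h
  refine ⟨isNoetherianRing_of_ringEquiv T e.symm, e.symm.isLocalRing, s.map e.symm.toEquiv.toEmbedding, ?_, ?_⟩
  · have h3 : IsLocalRing S := e.symm.isLocalRing
    rw [IsLocalRing.jacobson_eq_maximalIdeal ⊥ bot_ne_top] at hs ⊢
    have : ((s.map e.symm.toEquiv.toEmbedding : Finset S) : Set S) = (e.symm : T →+* S) '' (s : Set T) := by
      ext; simp
    rw [this, ← Ideal.map_span, hs]
    exact IsLocalRing.map_ringEquiv_maximalIdeal e.symm 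
  · rw [Finset.card_map, hc, ringKrullDim_eq_of_ringEquiv e]

theorem proj_reg (k : Type) {B : Type} [Field k] [CommRing B] [IsDomain B] [Algebra k B]
    (H : ℕ → Submodule k B) [GradedAlgebra H] (P : AlgebraicGeometry.Proj H)
    (KK : ℕ → Set B) (hKH : ∀ l a, a ∈ KK l → a ∈ H l)
    (hone : (1 : B) ∈ KK 0)
    (hmul : ∀ {i j a b}, a ∈ KK i → b ∈ KK j → a * b ∈ KK (i + j))
    (hprop : ∀ i a b, a ∈ KK i → b ∈ KK i → b ≠ 0 → ∃ c : k, a = c • b)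
    {u : B} {n : ℕ} (hn : n ≠ 0) (hu : u ∈ KK n) (huP : u ∉ P.asHomogeneousIdeal.toIdeal)
    {s : B} {ds : ℕ} (hs : s ∈ H ds) (hs0 : s ≠ 0)
    (hfrac : ∀ i e, e ∈ H i → ∃ j c, c ≠ 0 ∧ c ∈ grS k KK s ds j ∧ c * e ∈ grS k KK s ds (i + j)) :
    IsRegLocalRing ((AlgebraicGeometry.Proj H).presheaf.stalk P) := by
  have hu0 : u ≠ 0 := by rintro rfl; exact huP (Ideal.zero_mem _)
  have hPp : P.asHomogeneousIdeal.toIdeal.IsPrime := P.isPrime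
  let K := FractionRing B
  obtain ⟨q, w, hw, hfr⟩ := reg_field H (SetLike.GradedOne.one_mem) (fun h1 h2 => SetLike.GradedMul.mul_mem h1 h2)
    KK hKH hone hmul hprop hn hu hu0 hs hs0 hfrac K
  let O := HomogeneousLocalization.AtPrime H P.asHomogeneousIdeal.toIdeal
  let e : (AlgebraicGeometry.Proj H).presheaf.stalk P ≃+* O := AlgebraicGeometry.Proj.stalkIso' H P
  refine IsRegLocalRing.of_equiv e ?_
  have inj : Function.Injective (algebraMap B K) := IsFractionRing.injective B K
  have hunit : ∀ y : P.asHomogeneousIdeal.toIdeal.primeCompl, IsUnit (algebraMap B K y) := by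
    intro y
    apply IsUnit.mk0
    intro h
    have : (y : B) = 0 := inj (by rw [h, map_zero])
    exact y.2 (by rw [this]; exact Ideal.zero_mem _)
  have hle : P.asHomogeneousIdeal.toIdeal.primeCompl ≤ nonZeroDivisors B := by
    intro y hy
    refine mem_nonZeroDivisors_of_ne_zero ?_
    rintro rfl
    exact hy (Ideal.zero_mem _)
  let F : Localization.AtPrime P.asHomogeneousIdeal.toIdeal →+* K := IsLocalization.lift hunit
  have Finj : Function.Injective F := by
    rw [IsLocalization.lift_injective_iff]
    intro x y
    rw [(IsLocalization.injective (Localization.AtPrime P.asHomogeneousIdeal.toIdeal) hle).eq_iff, inj.eq_iff]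
  let J : O →+* K := F.comp (algebraMap O (Localization.AtPrime P.asHomogeneousIdeal.toIdeal))
  have Jinj : Function.Injective J :=
    Finj.comp (HomogeneousLocalization.val_injective P.asHomogeneousIdeal.toIdeal.primeCompl)
  have Jmk : ∀ c : HomogeneousLocalization.NumDenSameDeg H P.asHomogeneousIdeal.toIdeal.primeCompl,
      J (HomogeneousLocalization.mk c) = algebraMap B K c.num / algebraMap B K c.den := by
    intro c
    change F (HomogeneousLocalization.val (HomogeneousLocalization.mk c)) = _
    rw [HomogeneousLocalization.val_mk, Localization.mk_eq_mk', IsLocalization.lift_mk'_spec]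
    have : algebraMap B K c.den ≠ 0 := (hunit ⟨c.den, c.den_mem⟩).ne_zero
    exact (by rw [mul_comm, div_mul_cancel₀ _ this])
  have hdom : IsDomain O := Jinj.isDomain J
  let φ0 : k →+* O := (HomogeneousLocalization.fromZeroRingHom H _).comp (algebraMap k (H 0))
  have hφ0 : ∀ c, J (φ0 c) = algebraMap k K c := by
    intro c
    change J (HomogeneousLocalization.mk _) = _
    rw [Jmk]
    simp [IsScalarTower.algebraMap_apply k B K]
  have hV : u ^ q ∈ H (q * n) := by
    have := SetLike.pow_mem_graded q (hKH _ _ hu); rwa [smul_eq_mul] at this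
  let V : O := HomogeneousLocalization.mk ⟨q * n, ⟨w, hw⟩, ⟨u ^ q, hV⟩,
    (fun h => huP (hPp.mem_of_pow_mem q h))⟩
  have hJV : J V = algebraMap B K w / algebraMap B K (u ^ q) := Jmk _
  let φ : Polynomial k →+* O := Polynomial.eval₂RingHom φ0 V
  have hφ : ∀ p, J (φ p) = Polynomial.aeval (algebraMap B K w / algebraMap B K (u ^ q)) p := by
    intro p
    change J (Polynomial.eval₂ φ0 V p) = _
    rw [Polynomial.hom_eval₂, hJV, Polynomial.aeval_def]
    congr 1
    ext c; exact hφ0 c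
  refine reg_of_pid φ ?_
  intro x
  obtain ⟨c, rfl⟩ := HomogeneousLocalization.mk_surjective x
  have hd0 : (c.den : B) ≠ 0 := fun h => c.den_mem (by rw [h]; exact Ideal.zero_mem _)
  obtain ⟨p, r, hr, hpr⟩ := hfr c.deg c.num c.den c.num.2 c.den.2 hd0
  refine ⟨p, r, ?_, ?_⟩
  · intro h
    apply hr
    rw [← hφ, h, map_zero]
  · apply Jinj
    rw [map_mul, Jmk, hφ, hφ, mul_div_assoc', hpr, mul_div_cancel_right₀]
    rwa [Ne, map_eq_zero_iff _ inj]

section E1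
variable {k B : Type} [Field k] [CharZero k] [CommRing B] [IsDomain B] [Algebra k B]

theorem lnd_alg (D : Derivation k B B) (hD : IsLND D) {s : B} (hs1 : D s ≠ 0) (hs2 : D (D s) = 0)
    (A : Subalgebra k B) (hA : ∀ a, D a = 0 → a ∈ A) (hsA : s ∈ A) :
    Algebra.IsAlgebraic A B := by
  have hcz := charzero_alg k B
  have : ∀ N e, (⇑D)^[N] e = 0 → IsAlgebraic A e := by
    intro N
    induction N with
    | zero => 
      intro e he
      have : e = 0 := he
      rw [this]; exact isAlgebraic_zero
    | succ N ih =>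
      intro e he
      have h1 := ih _ (lnd_reduce D hs2 N he)
      have h2 : D ((⇑D)^[N] e) = 0 := by have := he; rwa [Function.iterate_succ_apply'] at this
      have h3 : IsAlgebraic A ((⇑D)^[N] e * s ^ N) :=
        isAlgebraic_algebraMap (⟨_, A.mul_mem (hA _ h2) (A.pow_mem hsA N)⟩ : A)
      have h4 := h1.add h3
      rw [sub_add_cancel] at h4
      refine IsAlgebraic.of_mul (y := (N.factorial : B) * (D s) ^ N) ?_ ?_ h4
      · refine mem_nonZeroDivisors_of_ne_zero (mul_ne_zero ?_ (pow_ne_zero _ hs1))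
        exact_mod_cast N.factorial_ne_zero
      · exact isAlgebraic_algebraMap (⟨_, A.mul_mem (A.natCast_mem _) (A.pow_mem (hA _ hs2) N)⟩ : A)
  exact ⟨fun e => (hD e).elim fun N hN => this N e hN⟩

theorem lnd_transc (D : Derivation k B B) {s : B} (hs1 : D s ≠ 0)
    (A : Subalgebra k B) (hA : ∀ a ∈ A, D a = 0) :
    Transcendental A s := by
  have hcz := charzero_alg k B
  have hczA : CharZero A := charzero_alg k A
  let D' : Derivation A B B := Derivation.mk' 
    { toFun := D, map_add' := map_add D, map_smul' := by
        intro a x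
        simp [Algebra.smul_def, Subalgebra.algebraMap_def, hA _ a.2] }
    (by intro a b; simp )
  have hD' : ∀ x, D' x = D x := fun _ => rfl
  have : ∀ n (p : Polynomial A), p.natDegree ≤ n → Polynomial.aeval s p = 0 → p = 0 := by
    intro n
    induction n with
    | zero =>
      intro p hp h
      rw [Polynomial.eq_C_of_natDegree_le_zero hp, Polynomial.aeval_C] at h
      rw [Polynomial.eq_C_of_natDegree_le_zero hp]
      have : p.coeff 0 = 0 := Subtype.ext h
      rw [this, map_zero]
    | succ n ih =>
      intro p hp h
      have h1 := D'.map_aeval p s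
      rw [h, map_zero, hD', smul_eq_mul] at h1
      have h2 := (mul_eq_zero.1 h1.symm).resolve_right hs1
      have h3 := ih _ ((Polynomial.natDegree_derivative_le p).trans (by omega)) h2
      have h4 := Polynomial.derivative_eq_zero.1 h3
      rw [Polynomial.eq_C_of_natDegree_eq_zero h4, Polynomial.aeval_C] at h
      rw [Polynomial.eq_C_of_natDegree_eq_zero h4]
      have : p.coeff 0 = 0 := Subtype.ext h
      rw [this, map_zero]
  rw [transcendental_iff]
  exact fun p hp => this _ p le_rfl hp
end E1

theorem quot_dep {k : Type} [Field k] {q : MvPolynomial (Fin 3) k} (hq : q ≠ 0)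
    {ι : Type} [Fintype ι] (hι : Fintype.card ι = 3) 
    (x : ι → MvPolynomial (Fin 3) k ⧸ Ideal.span {q}) (hx : AlgebraicIndependent k x) : False := by
  choose y hy using fun i => Ideal.Quotient.mk_surjective (x i)
  have hxy : ∀ p : MvPolynomial ι k, Ideal.Quotient.mk (Ideal.span {q}) (aeval y p) = aeval x p := by
    intro p
    have : x = fun i => Ideal.Quotient.mkₐ k (Ideal.span {q}) (y i) := by ext i; exact (hy i).symm
    rw [this]
    exact MvPolynomial.comp_aeval_apply y (Ideal.Quotient.mkₐ k (Ideal.span {q})) p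
  have hyi : AlgebraicIndependent k y := by
    rw [algebraicIndependent_iff] at hx ⊢
    intro p hp
    apply hx
    rw [← hxy, hp, map_zero]
  have hb : IsTranscendenceBasis k y := by
    apply hyi.isTranscendenceBasis_of_trdeg_le_of_finite
    rw [MvPolynomial.trdeg_of_isDomain]; simp [hι]
  have halg := hb.isAlgebraic
  obtain ⟨⟨r, hr⟩, hr0, hdvd⟩ := (halg.isAlgebraic q).exists_nonzero_dvd (mem_nonZeroDivisors_of_ne_zero hq)
  rw [Algebra.adjoin_range_eq_range_aeval] at hr
  obtain ⟨p, hp⟩ := hr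
  have hdvd' : q ∣ aeval y p := by
    have e : (aeval y) p = r := hp
    rw [e]; exact hdvd
  have h0 : aeval x p = 0 := by
    rw [← hxy, Ideal.Quotient.eq_zero_iff_mem, Ideal.mem_span_singleton]; exact hdvd'
  rw [algebraicIndependent_iff] at hx
  have := hx p h0
  apply hr0
  ext1
  change r = 0
  have e : (aeval y) p = r := hp
  rw [← e, this, map_zero]

theorem gh_indep {k : Type} [Field k] [CharZero k]
    (D : Derivation k (MvPolynomial (Fin 3) k) (MvPolynomial (Fin 3) k)) (hD : IsLND D)
    {s : MvPolynomial (Fin 3) k} (hs1 : D s ≠ 0) (hs2 : D (D s) = 0) (g h : MvPolynomial (Fin 3) k)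
    (hker : ∀ r, D r = 0 → r ∈ Algebra.adjoin k ({g, h} : Set (MvPolynomial (Fin 3) k))) :
    AlgebraicIndependent k ![g, h, s] := by
  have hr : Set.range ![g, h, s] = {g, h, s} := by
    ext x; simp [Matrix.range_cons]; tauto
  have : Algebra.IsAlgebraic (Algebra.adjoin k (Set.range ![g, h, s])) (MvPolynomial (Fin 3) k) := by
    apply lnd_alg D hD hs1 hs2
    · intro a ha
      refine Algebra.adjoin_mono ?_ (hker a ha)
      rw [hr]; intro x hx; simp at hx ⊢; tauto
    · apply Algebra.subset_adjoin
      rw [hr]; simp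
  have := Algebra.IsAlgebraic.isTranscendenceBasis_of_le_trdeg_of_finite k ![g, h, s]
    (by rw [MvPolynomial.trdeg_of_isDomain]; simp)
  exact this.1

theorem hom_indep2_aux {k B : Type} [Field k] [IsAlgClosed k] [CommRing B] [IsDomain B] [Algebra k B]
    (H : ℕ → Submodule k B)
    (Hone : (1 : B) ∈ H 0) (Hmul : ∀ {i j a b}, a ∈ H i → b ∈ H j → a * b ∈ H (i + j))
    {l : ℕ} 
    (Hind : ∀ (N : ℕ) (F : ℕ → B), (∀ n, F n ∈ H (n * l)) → ∑ n ∈ Finset.range N, F n = 0 →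
      ∀ n < N, F n = 0)
    {a b : B} (ha : a ∈ H l) (hb : b ∈ H l) (hb0 : b ≠ 0) (hab : ∀ c : k, a ≠ c • b)
    (K : Type) [Field K] [Algebra k K] [Algebra B K] [IsScalarTower k B K] [FaithfulSMul B K] :
    AlgebraicIndependent k ![a, b] := by
  classical
  have inj : Function.Injective (algebraMap B K) := FaithfulSMul.algebraMap_injective B K
  have Hpow : ∀ {i x}, x ∈ H i → ∀ m : ℕ, x ^ m ∈ H (m * i) := by
    intro i x hx m
    induction m with
    | zero => simpa using Hone
    | succ m ih => rw [pow_succ, Nat.succ_mul]; exact Hmul ih hx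
  have hbK : algebraMap B K b ≠ 0 := by rwa [Ne, map_eq_zero_iff _ inj]
  let t : K := algebraMap B K a / algebraMap B K b
  have htb : algebraMap B K a = t * algebraMap B K b := by
    simp only [t]; rw [div_mul_cancel₀ _ hbK]
  have ht : Transcendental k t := by
    intro halg
    have hint : IsIntegral k t := halg.isIntegral
    obtain ⟨c, hc⟩ := minpoly.mem_range_of_degree_eq_one k t
      (IsAlgClosed.degree_eq_one_of_irreducible k (minpoly.irreducible hint))
    apply hab c
    apply inj
    rw [htb, ← hc, Algebra.smul_def, map_mul, ← IsScalarTower.algebraMap_apply]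
  have hexp : ∀ Q : MvPolynomial (Fin 2) k, aeval ![a, b] Q =
      ∑ d ∈ Q.support, Q.coeff d • (a ^ d 0 * b ^ d 1) := by
    intro Q
    rw [MvPolynomial.aeval_def, MvPolynomial.eval₂_eq']
    apply Finset.sum_congr rfl
    intro d _
    rw [Fin.prod_univ_two, Algebra.smul_def]; rfl
  have hhom : ∀ (Q : MvPolynomial (Fin 2) k) n, Q.IsHomogeneous n → aeval ![a, b] Q ∈ H (n * l) := by
    intro Q n hQ
    rw [hexp]
    apply Submodule.sum_mem
    intro d hd
    apply Submodule.smul_mem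
    have h1 := hQ (MvPolynomial.mem_support_iff.1 hd)
    have h2 : d 0 + d 1 = n := by
      rw [← h1, Finsupp.weight_apply, Finsupp.sum_fintype _ _ (by simp), Fin.sum_univ_two]; simp
    rw [← h2, add_mul]
    exact Hmul (Hpow ha _) (Hpow hb _)
  have hzero : ∀ (Q : MvPolynomial (Fin 2) k) n, Q.IsHomogeneous n → aeval ![a, b] Q = 0 → Q = 0 := by
    intro Q n hQ h0
    have hdeg : ∀ d ∈ Q.support, d 0 + d 1 = n := by
      intro d hd
      have h1 := hQ (MvPolynomial.mem_support_iff.1 hd)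
      rw [← h1, Finsupp.weight_apply, Finsupp.sum_fintype _ _ (by simp), Fin.sum_univ_two]; simp
    let p : Polynomial k := ∑ d ∈ Q.support, Polynomial.C (Q.coeff d) * Polynomial.X ^ d 0
    have hp : Polynomial.aeval t p = 0 := by
      have h1 : algebraMap B K b ^ n * Polynomial.aeval t p = algebraMap B K (aeval ![a, b] Q) := by
        rw [hexp]
        simp only [p, map_sum, Finset.mul_sum]
        apply Finset.sum_congr rfl
        intro d hd
        rw [← hdeg d hd, Algebra.smul_def]
        simp only [map_mul, map_pow, Polynomial.aeval_C, Polynomial.aeval_X, htb,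
          ← IsScalarTower.algebraMap_apply]
        ring
      rw [h0, map_zero] at h1
      exact (mul_eq_zero.1 h1).resolve_left (pow_ne_zero _ hbK)
    have hp0 : p = 0 := by
      rw [transcendental_iff] at ht
      exact ht p hp
    ext d
    rw [MvPolynomial.coeff_zero]
    by_contra hd
    have hd' : d ∈ Q.support := MvPolynomial.mem_support_iff.2 hd
    have : p.coeff (d 0) = Q.coeff d := by
      simp only [p, Polynomial.finset_sum_coeff, Polynomial.coeff_C_mul, Polynomial.coeff_X_pow]
      rw [Finset.sum_eq_single d]
      · simp
      · intro d2 hd2 hne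
        rw [if_neg, mul_zero]
        intro heq
        apply hne
        have e1 := hdeg d hd'
        have e2 := hdeg d2 hd2
        ext i
        fin_cases i
        · exact heq.symm
        · change d2 1 = d 1
          omega
      · intro h; exact absurd hd' h
    rw [hp0, Polynomial.coeff_zero] at this
    exact hd this.symm
  rw [algebraicIndependent_iff]
  intro P hP
  have hsum := MvPolynomial.sum_homogeneousComponent P
  have h1 : ∑ n ∈ Finset.range (P.totalDegree + 1), aeval ![a, b] (homogeneousComponent n P) = 0 := by
    rw [← map_sum, hsum, hP]
  have h2 := Hind _ (fun n => aeval ![a, b] (homogeneousComponent n P))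
    (fun n => hhom _ n (homogeneousComponent_isHomogeneous n P)) h1
  rw [← hsum]
  apply Finset.sum_eq_zero
  intro n hn
  exact hzero _ n (homogeneousComponent_isHomogeneous n P) (h2 n (Finset.mem_range.1 hn))

theorem comp_mem_span {k : Type} [Field k] {q : MvPolynomial (Fin 3) k} {dq : ℕ}
    (hq : q.IsWeightedHomogeneous w3 dq) {r : MvPolynomial (Fin 3) k} (hr : r ∈ Ideal.span {q}) (i : ℕ) :
    weightedHomogeneousComponent w3 i r ∈ Ideal.span {q} := by
  classical
  letI := MvPolynomial.weightedGradedAlgebra k w3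
  refine weightedHomogeneousComponent_mem_of_mem k w3 ?_ hr i
  apply Ideal.homogeneous_span
  intro x hx
  rw [Set.mem_singleton_iff.1 hx]
  exact ⟨dq, hq⟩

theorem wh_zero_const {k : Type} [Field k] {r : MvPolynomial (Fin 3) k}
    (hr : r.IsWeightedHomogeneous w3 0) : r = C (coeff 0 r) := by
  have h := weightedHomogeneousComponent_zero (w := w3) (φ := r) (by intro i; fin_cases i <;> simp [w3])
  rwa [hr.weightedHomogeneousComponent_same] at h

/-- induced grading on the quotient -/
def qH (k : Type) [Field k] (q : MvPolynomial (Fin 3) k) (i : ℕ) :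
    Submodule k (MvPolynomial (Fin 3) k ⧸ Ideal.span {q}) :=
  (weightedHomogeneousSubmodule k w3 i).map (Ideal.Quotient.mkₐ k (Ideal.span {q})).toLinearMap

theorem mem_qH {k : Type} [Field k] {q : MvPolynomial (Fin 3) k} {i : ℕ}
    {x : MvPolynomial (Fin 3) k ⧸ Ideal.span {q}} :
    x ∈ qH k q i ↔ ∃ r : MvPolynomial (Fin 3) k, r.IsWeightedHomogeneous w3 i ∧
      Ideal.Quotient.mk (Ideal.span {q}) r = x := Iff.rfl

theorem qH_ind {k : Type} [Field k] {q : MvPolynomial (Fin 3) k} {dq : ℕ}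
    (hq : q.IsWeightedHomogeneous w3 dq) {l : ℕ} (hl : l ≠ 0) 
    (N : ℕ) (F : ℕ → MvPolynomial (Fin 3) k ⧸ Ideal.span {q}) (hF : ∀ n, F n ∈ qH k q (n * l))
    (h0 : ∑ n ∈ Finset.range N, F n = 0) : ∀ n < N, F n = 0 := by
  classical
  choose r hr hrF using fun n => mem_qH.1 (hF n)
  intro n hn
  have h1 : ∑ n ∈ Finset.range N, r n ∈ Ideal.span {q} := by
    rw [← Ideal.Quotient.eq_zero_iff_mem, map_sum, ← h0]
    exact Finset.sum_congr rfl fun n _ => hrF n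
  have h2 := comp_mem_span hq h1 (n * l)
  rw [map_sum, Finset.sum_eq_single n, (hr n).weightedHomogeneousComponent_same] at h2
  · rw [← hrF, Ideal.Quotient.eq_zero_iff_mem]; exact h2
  · intro m _ hmn
    refine (hr m).weightedHomogeneousComponent_ne _ ?_
    intro h
    exact hmn (Nat.eq_of_mul_eq_mul_right (Nat.pos_of_ne_zero hl) h.symm)
  · intro h; exact absurd (Finset.mem_range.2 hn) h

theorem qH_one {k : Type} [Field k] {q : MvPolynomial (Fin 3) k} : 1 ∈ qH k q 0 :=
  mem_qH.2 ⟨1, isWeightedHomogeneous_one _ _, map_one _⟩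

theorem qH_mul {k : Type} [Field k] {q : MvPolynomial (Fin 3) k} {i j : ℕ} 
    {a b : MvPolynomial (Fin 3) k ⧸ Ideal.span {q}} (ha : a ∈ qH k q i) (hb : b ∈ qH k q j) :
    a * b ∈ qH k q (i + j) := by
  obtain ⟨r, hr, rfl⟩ := mem_qH.1 ha
  obtain ⟨r', hr', rfl⟩ := mem_qH.1 hb
  exact mem_qH.2 ⟨r * r', hr.mul hr', map_mul _ _ _⟩

theorem qH_zero_const {k : Type} [Field k] {q : MvPolynomial (Fin 3) k}
    {a : MvPolynomial (Fin 3) k ⧸ Ideal.span {q}} (ha : a ∈ qH k q 0) : ∃ c : k, a = algebraMap k _ c := by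
  obtain ⟨r, hr, rfl⟩ := mem_qH.1 ha
  exact ⟨coeff 0 r, by conv_lhs => rw [wh_zero_const hr]
                       rfl⟩

theorem exists_slice {k B : Type} [Field k] [CommRing B] [Algebra k B]
    (D : Derivation k B B) (hD : IsLND D) {e : B} (he : D e ≠ 0) :
    ∃ N, D ((⇑D)^[N] e) ≠ 0 ∧ D (D ((⇑D)^[N] e)) = 0 := by
  classical
  have h := hD (D e)
  have h0 : Nat.find h ≠ 0 := by
    intro h0
    have := Nat.find_spec h
    rw [h0] at this
    exact he this
  obtain ⟨N, hN⟩ := Nat.exists_eq_succ_of_ne_zero h0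
  refine ⟨N, ?_, ?_⟩
  · have := Nat.find_min h (m := N) (by omega)
    rwa [← Function.iterate_succ_apply, Function.iterate_succ_apply'] at this
  · have := Nat.find_spec h
    rwa [hN, ← Function.iterate_succ_apply, Function.iterate_succ_apply', Function.iterate_succ_apply'] at this

theorem exists_X_not_mem {k : Type} [Field k] {q : MvPolynomial (Fin 3) k} (hq : ¬ IsUnit q)
    (D : Derivation k (MvPolynomial (Fin 3) k) (MvPolynomial (Fin 3) k)) (hirr : IsIrreducibleDeriv D) :
    ∃ i, D (X i) ∉ Ideal.span {q} := by
  by_contra! hc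
  apply hq
  apply hirr
  intro r
  induction r using MvPolynomial.induction_on with
  | C a =>
    have : D (C a) = 0 := D.map_algebraMap a
    rw [this]; exact Ideal.zero_mem _
  | add p q h1 h2 => rw [map_add]; exact Ideal.add_mem _ h1 h2
  | mul_X p i h => 
    rw [Derivation.leibniz]
    exact Ideal.add_mem _ (Ideal.mul_mem_left _ _ (hc i)) (Ideal.mul_mem_left _ _ h)

theorem quot_setup {k : Type} [Field k] [IsAlgClosed k] [CharZero k] {q : MvPolynomial (Fin 3) k}
    {dq : ℕ} (hq : q.IsWeightedHomogeneous w3 dq) (hqi : Irreducible q)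
    (D : Derivation k (MvPolynomial (Fin 3) k) (MvPolynomial (Fin 3) k))
    (hlnd : IsLND D) (hirr : IsIrreducibleDeriv D) {m : ℤ} (hhom : DerivIsHomogOfDeg w3 D m)
    (hDq : D q = 0) :
    ∃ δ : Derivation k (MvPolynomial (Fin 3) k ⧸ Ideal.span {q}) (MvPolynomial (Fin 3) k ⧸ Ideal.span {q}),
      (∀ r, δ (Ideal.Quotient.mk _ r) = Ideal.Quotient.mk _ (D r)) ∧ GrSetup k (qH k q) δ m ∧
      ∃ s ds, s ∈ qH k q ds ∧ δ s ≠ 0 ∧ δ (δ s) = 0 := by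
  have hprime : (Ideal.span {q}).IsPrime := (Ideal.span_singleton_prime hqi.ne_zero).2 hqi.prime
  have hdom : IsDomain (MvPolynomial (Fin 3) k ⧸ Ideal.span {q}) := Ideal.Quotient.isDomain _
  have hd : ∀ x, Ideal.Quotient.mkₐ k (Ideal.span {q}) x = 0 → Ideal.Quotient.mkₐ k (Ideal.span {q}) (D x) = 0 := by
    intro x hx
    rw [Ideal.Quotient.mkₐ_eq_mk] at hx ⊢
    rw [Ideal.Quotient.eq_zero_iff_mem, Ideal.mem_span_singleton] at hx ⊢
    obtain ⟨c, rfl⟩ := hx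
    rw [Derivation.leibniz, hDq, smul_zero, add_zero]
    exact Dvd.intro _ rfl
  let δ := Derivation.liftOfSurjective (Ideal.Quotient.mkₐ_surjective k (Ideal.span {q})) hd
  have hδ : ∀ r, δ (Ideal.Quotient.mk _ r) = Ideal.Quotient.mk _ (D r) := 
    fun r => Derivation.liftOfSurjective_apply (Ideal.Quotient.mkₐ_surjective k (Ideal.span {q})) hd r
  have hiter : ∀ n r, (⇑δ)^[n] (Ideal.Quotient.mk _ r) = Ideal.Quotient.mk _ ((⇑D)^[n] r) := by
    intro n
    induction n with
    | zero => intro r; rfl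
    | succ n ih => intro r; rw [Function.iterate_succ_apply, Function.iterate_succ_apply, hδ, ih]
  have hδlnd : IsLND δ := by
    intro b
    obtain ⟨r, rfl⟩ := Ideal.Quotient.mk_surjective b
    obtain ⟨n, hn⟩ := hlnd r
    exact ⟨n, by rw [hiter, hn, map_zero]⟩
  have hδhom : ∀ i a, a ∈ qH k q i → 
      (∀ j : ℕ, (j : ℤ) = i + m → δ a ∈ qH k q j) ∧ ((i : ℤ) + m < 0 → δ a = 0) := by
    intro i a ha
    obtain ⟨r, hr, rfl⟩ := mem_qH.1 ha
    obtain ⟨h1, h2⟩ := hhom i r hr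
    refine ⟨fun j hj => ?_, fun h => ?_⟩
    · rw [hδ]; exact mem_qH.2 ⟨_, h1 j hj, rfl⟩
    · rw [hδ, h2 h, map_zero]
  obtain ⟨i, hi⟩ := exists_X_not_mem hqi.not_isUnit D hirr
  have hXi : Ideal.Quotient.mk (Ideal.span {q}) (X i) ∈ qH k q (w3 i) :=
    mem_qH.2 ⟨X i, isWeightedHomogeneous_X _ _ _, rfl⟩
  have hδX : δ (Ideal.Quotient.mk (Ideal.span {q}) (X i)) ≠ 0 := by
    rw [hδ, Ne, Ideal.Quotient.eq_zero_iff_mem]; exact hi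
  obtain ⟨N, hs1, hs2⟩ := exists_slice δ hδlnd hδX
  obtain ⟨ds, -, hds⟩ := iter_hom hδhom hXi N (by intro h; rw [h, map_zero] at hs1; exact hs1 rfl)
  refine ⟨δ, hδ, ⟨qH_one, qH_mul, hδhom, hδlnd, ?_⟩, _, ds, hds, hs1, hs2⟩
  intro l a b ha hb hδa hδb hb0
  by_contra! hc
  by_cases hl : l = 0
  · subst hl
    obtain ⟨ca, hca⟩ := qH_zero_const ha
    obtain ⟨cb, hcb⟩ := qH_zero_const hb
    have hcb0 : cb ≠ 0 := by rintro rfl; rw [map_zero] at hcb; exact hb0 hcb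
    apply hc (ca / cb)
    rw [hca, hcb, Algebra.smul_def, ← map_mul, div_mul_cancel₀ _ hcb0]
  · have hab := hom_indep2_aux (qH k q) qH_one qH_mul (qH_ind hq hl) ha hb hb0 hc
      (FractionRing (MvPolynomial (Fin 3) k ⧸ Ideal.span {q}))
    have htr : Transcendental (Algebra.adjoin k (Set.range ![a, b])) 
        ((⇑δ)^[N] (Ideal.Quotient.mk (Ideal.span {q}) (X i))) := by
      refine lnd_transc δ hs1 _ ?_
      intro x hx
      induction hx using Algebra.adjoin_induction with
      | mem x hx =>
        obtain ⟨j, rfl⟩ := hx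
        fin_cases j
        · exact hδa
        · exact hδb
      | algebraMap r => exact δ.map_algebraMap r
      | add x y _ _ h1 h2 => rw [map_add, h1, h2, add_zero]
      | mul x y _ _ h1 h2 => rw [Derivation.leibniz, h1, h2, smul_zero, smul_zero, add_zero]
    exact quot_dep hqi.ne_zero (by simp) _ ((hab.option_iff_transcendental _).2 htr)


theorem ker_eq_range {k : Type} [Field k] {g h : MvPolynomial (Fin 3) k} {r : MvPolynomial (Fin 3) k}
    (hr : r ∈ Algebra.adjoin k ({g, h} : Set (MvPolynomial (Fin 3) k))) :
    ∃ p : MvPolynomial (Fin 2) k, aeval ![g, h] p = r := by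
  have hs : Set.range ![g, h] = {g, h} := by simp [Matrix.range_cons, Set.pair_comm]
  rw [← hs, Algebra.adjoin_range_eq_range_aeval] at hr
  exact hr

theorem gen_irr {k : Type} [Field k] [CharZero k]
    (D : Derivation k (MvPolynomial (Fin 3) k) (MvPolynomial (Fin 3) k)) (hD : IsLND D)
    {g h : MvPolynomial (Fin 3) k} (hind : AlgebraicIndependent k ![g, h])
    (hker : ∀ r, D r = 0 → r ∈ Algebra.adjoin k ({g, h} : Set (MvPolynomial (Fin 3) k)))
    (hDg : D g = 0) (hDh : D h = 0) : Irreducible g ∧ ¬ g ∣ h ∧ ∀ c, g ≠ C c := by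
  have hc : ∀ c, g ≠ C c := by
    intro c hc
    have h1 : aeval ![g, h] (X 0 - C c : MvPolynomial (Fin 2) k) = 0 := by
      rw [map_sub, aeval_X, MvPolynomial.aeval_C]; simp [hc]
    have h2 := (algebraicIndependent_iff.1 hind) _ h1
    have h3 := congrArg (fun p => MvPolynomial.eval (fun _ => c + 1) p) h2
    simp at h3
  have hg0 : g ≠ 0 := by intro h0; exact hc 0 (by rw [h0, map_zero])
  have hh0 : h ≠ 0 := by 
    intro h0
    have h1 : aeval ![g, h] (X 1 : MvPolynomial (Fin 2) k) = 0 := by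
      rw [aeval_X]; simp [h0]
    exact X_ne_zero 1 ((algebraicIndependent_iff.1 hind) _ h1)
  refine ⟨⟨?_, ?_⟩, ?_, hc⟩
  · intro hu
    obtain ⟨c, -, h1⟩ := MvPolynomial.isUnit_iff_eq_C_of_isReduced.1 hu
    exact hc c h1
  · intro a b hab
    have hab0 : a * b ≠ 0 := hab ▸ hg0
    have hDab : D (a * b) = 0 := hab ▸ hDg
    obtain ⟨p, rfl⟩ := ker_eq_range (hker a (lnd_fact_closed D hD hab0 hDab))
    obtain ⟨q, rfl⟩ := ker_eq_range (hker b (lnd_fact_closed D hD (by rwa [mul_comm] at hab0) (by rwa [mul_comm] at hDab)))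
    have h1 : aeval ![g, h] (X 0 : MvPolynomial (Fin 2) k) = aeval ![g, h] (p * q) := by
      rw [map_mul, ← hab, aeval_X]; rfl
    have h2 : (X 0 : MvPolynomial (Fin 2) k) = p * q := hind h1
    have h3 : Irreducible (X 0 : MvPolynomial (Fin 2) k) := (MvPolynomial.X_prime (i := (0 : Fin 2))).irreducible
    rcases h3.isUnit_or_isUnit h2 with h4 | h4
    · exact Or.inl (h4.map (aeval ![g, h]))
    · exact Or.inr (h4.map (aeval ![g, h]))
  · rintro ⟨c, hcc⟩
    have hab0 : c * g ≠ 0 := by rw [mul_comm, ← hcc]; exact hh0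
    have hDab : D (c * g) = 0 := by rw [mul_comm, ← hcc]; exact hDh
    obtain ⟨p, rfl⟩ := ker_eq_range (hker c (lnd_fact_closed D hD hab0 hDab))
    have h1 : aeval ![g, h] (X 1 : MvPolynomial (Fin 2) k) = aeval ![g, h] (X 0 * p) := by
      rw [map_mul, aeval_X, aeval_X]; exact hcc
    have h2 : (X 1 : MvPolynomial (Fin 2) k) = X 0 * p := hind h1
    have h3 := congrArg (fun p => MvPolynomial.eval ![0, 1] p) h2
    simp at h3

theorem ker_hom_span {k : Type} [Field k] {g h : MvPolynomial (Fin 3) k} {d e : ℕ}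
    (hg : g.IsWeightedHomogeneous w3 d) (hh : h.IsWeightedHomogeneous w3 e)
    {r : MvPolynomial (Fin 3) k} {i : ℕ} (hri : r.IsWeightedHomogeneous w3 i)
    (hr : r ∈ Algebra.adjoin k ({g, h} : Set (MvPolynomial (Fin 3) k))) :
    r ∈ Submodule.span k {x | ∃ a b, a * d + b * e = i ∧ x = g ^ a * h ^ b} := by
  classical
  obtain ⟨Q, hQ⟩ := ker_eq_range hr
  have hexp : aeval ![g, h] Q =
      ∑ d ∈ Q.support, Q.coeff d • (g ^ d 0 * h ^ d 1) := by
    rw [MvPolynomial.aeval_def, MvPolynomial.eval₂_eq']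
    apply Finset.sum_congr rfl
    intro d _
    rw [Fin.prod_univ_two, Algebra.smul_def]; rfl
  have h1 := hri.weightedHomogeneousComponent_same
  rw [← h1, ← hQ, hexp, map_sum]
  apply Submodule.sum_mem
  intro t _
  rw [map_smul]
  apply Submodule.smul_mem
  have h2 : (g ^ t 0 * h ^ t 1).IsWeightedHomogeneous w3 (t 0 * d + t 1 * e) := by
    simpa using (hg.pow (t 0)).mul (hh.pow (t 1))
  by_cases hi : t 0 * d + t 1 * e = i
  · rw [hi] at h2
    rw [h2.weightedHomogeneousComponent_same]
    exact Submodule.subset_span ⟨_, _, hi, rfl⟩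
  · rw [h2.weightedHomogeneousComponent_ne _ (Ne.symm hi)]
    exact Submodule.zero_mem _


theorem frac1 {k B : Type} [Field k] [CharZero k] [CommRing B] [IsDomain B] [Algebra k B]
    {H : ℕ → Submodule k B} {δ : Derivation k B B} {m : ℤ}
    (S : GrSetup k H δ m)
    {s : B} {ds : ℕ} (hs : s ∈ H ds) (hs1 : δ s ≠ 0) (hs2 : δ (δ s) = 0) :
    ∀ (N i : ℕ) (e : B), e ∈ H i → (⇑δ)^[N] e = 0 →
      ∃ j c, c ≠ 0 ∧ c ∈ H j ∧ δ c = 0 ∧ c * e ∈ grS k (fun l => {a | a ∈ H l ∧ δ a = 0}) s ds (i + j) := by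
  have hcz := charzero_alg k B
  intro N
  induction N with
  | zero =>
    intro i e _ he
    refine ⟨0, 1, one_ne_zero, S.one, by simp, ?_⟩
    have : e = 0 := he
    rw [this, mul_zero]; exact Submodule.zero_mem _
  | succ N ih =>
    intro i e hei he
    by_cases h0 : (⇑δ)^[N] e = 0
    · exact ih i e hei h0
    obtain ⟨jN, hjN, hN⟩ := iter_hom S.hom hei N h0
    obtain ⟨j1, hj1, hδs⟩ := iter_hom S.hom hs 1 hs1
    rw [Function.iterate_one] at hδs
    have hδ0 : δ ((⇑δ)^[N] e) = 0 := (Function.iterate_succ_apply' _ _ _).symm.trans he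
    have hred := lnd_reduce δ hs2 N he
    have hfac : ((N.factorial : ℕ) : B) ∈ H 0 := by
      have : ((N.factorial : ℕ) : B) = (N.factorial : k) • (1 : B) := by
        rw [Algebra.smul_def, mul_one, map_natCast]
      rw [this]; exact Submodule.smul_mem _ _ S.one
    have hA : (N.factorial : B) * (δ s) ^ N ∈ H (N * j1) := by
      simpa using S.mul hfac (S.pow hδs N)
    have hdeg : jN + N * ds = N * j1 + i := by
      zify; rw [hjN, hj1]; push_cast; ring
    have hT : (⇑δ)^[N] e * s ^ N ∈ H (N * j1 + i) := hdeg ▸ S.mul hN (S.pow hs N)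
    obtain ⟨j, c, hc0, hcH, hδc, hce⟩ := ih _ _ (Submodule.sub_mem _ (S.mul hA hei) hT) hred
    refine ⟨N * j1 + j, c * ((N.factorial : B) * (δ s) ^ N), ?_, ?_, ?_, ?_⟩
    · exact mul_ne_zero hc0 (mul_ne_zero (by exact_mod_cast N.factorial_ne_zero) (pow_ne_zero _ hs1))
    · rw [add_comm]; exact S.mul hcH hA
    · simp [Derivation.leibniz, Derivation.leibniz_pow, hs2, hδc]
    · have h1 : c * ((N.factorial : B) * (δ s) ^ N) * e = c * ((N.factorial : B) * (δ s) ^ N * e - (⇑δ)^[N] e * s ^ N)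
          + (c * (⇑δ)^[N] e) * s ^ N := by ring
      rw [h1]
      have h2 : i + (N * j1 + j) = N * j1 + i + j := by ring
      rw [h2]
      refine Submodule.add_mem _ hce (Submodule.subset_span ⟨_, j + jN, N, ⟨S.mul hcH hN, ?_⟩, ?_, rfl⟩)
      · simp [Derivation.leibniz, hδc, hδ0]
      · rw [← hdeg]; ring

theorem frac2 {k : Type} [Field k] [CharZero k]
    (D : Derivation k (MvPolynomial (Fin 3) k) (MvPolynomial (Fin 3) k)) (hD : IsLND D)
    {m : ℤ} (hhom : DerivIsHomogOfDeg w3 D m)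
    {f : MvPolynomial (Fin 3) k} {df : ℕ} (hf : f.IsWeightedHomogeneous w3 df) (hfp : Prime f)
    (hs1 : D f ≠ 0) (hs2 : D (D f) = 0) :
    ∀ (N i : ℕ) (e : MvPolynomial (Fin 3) k), e.IsWeightedHomogeneous w3 i → (⇑D)^[N] e = 0 →
      ∃ j c α, ¬ f ∣ c ∧ c.IsWeightedHomogeneous w3 j ∧ D c = 0 ∧ D α = 0 ∧ 
        α.IsWeightedHomogeneous w3 (i + j) ∧ f ∣ c * e - α := by
  have hfDf : ¬ f ∣ D f := by
    rintro ⟨c, hc⟩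
    apply hs1
    exact lnd_fact_closed D hD (x := f) (y := c) (by rwa [← hc]) (by rwa [← hc])
  have hhom' : ∀ i a, a ∈ weightedHomogeneousSubmodule k w3 i → 
      (∀ j : ℕ, (j : ℤ) = i + m → D a ∈ weightedHomogeneousSubmodule k w3 j) ∧ ((i : ℤ) + m < 0 → D a = 0) :=
    hhom
  intro N
  induction N with
  | zero =>
    intro i e _ he
    have : e = 0 := he
    exact ⟨0, 1, 0, hfp.not_dvd_one, isWeightedHomogeneous_one _ _, by simp, by simp, 
      isWeightedHomogeneous_zero _ _ _, by simp [this]⟩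
  | succ N ih =>
    intro i e hei he
    by_cases h0 : (⇑D)^[N] e = 0
    · exact ih i e hei h0
    by_cases hN0 : N = 0
    · subst hN0
      exact ⟨0, 1, e, hfp.not_dvd_one, isWeightedHomogeneous_one _ _, by simp, he, 
        by simpa using hei, by simp⟩
    obtain ⟨jN, hjN, hN⟩ := iter_hom hhom' hei N h0
    obtain ⟨j1, hj1, hδs⟩ := iter_hom hhom' hf 1 hs1
    rw [Function.iterate_one] at hδs
    have hδ0 : D ((⇑D)^[N] e) = 0 := (Function.iterate_succ_apply' _ _ _).symm.trans he
    have hred := lnd_reduce D hs2 N he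
    have hfac : IsWeightedHomogeneous w3 ((N.factorial : ℕ) : MvPolynomial (Fin 3) k) 0 := by
      rw [← map_natCast (C : k →+* MvPolynomial (Fin 3) k)]; exact isWeightedHomogeneous_C _ _
    have hA : IsWeightedHomogeneous w3 ((N.factorial : MvPolynomial (Fin 3) k) * (D f) ^ N) (N * j1) := by
      simpa using hfac.mul (IsWeightedHomogeneous.pow hδs N)
    have hdeg : jN + N * df = N * j1 + i := by
      zify; rw [hjN, hj1]; push_cast; ring
    have hT : IsWeightedHomogeneous w3 ((⇑D)^[N] e * f ^ N) (N * j1 + i) := by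
      rw [← hdeg]; simpa using IsWeightedHomogeneous.mul hN (hf.pow N)
    obtain ⟨j, c, α, hc0, hcH, hδc, hα, hαH, hce⟩ := ih _ _ 
      (Submodule.sub_mem (weightedHomogeneousSubmodule k w3 _) (hA.mul hei) hT) hred
    refine ⟨N * j1 + j, c * ((N.factorial : MvPolynomial (Fin 3) k) * (D f) ^ N), α, ?_, ?_, ?_, hα, ?_, ?_⟩
    · intro hd
      rcases hfp.dvd_or_dvd hd with h | h
      · exact hc0 h
      rcases hfp.dvd_or_dvd h with h | h
      · refine hfp.not_isUnit (isUnit_of_dvd_unit h ?_)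
        rw [← map_natCast (C : k →+* MvPolynomial (Fin 3) k)]
        exact (IsUnit.mk0 _ (by exact_mod_cast N.factorial_ne_zero)).map _
      · exact hfDf (hfp.dvd_of_dvd_pow h)
    · rw [add_comm]; exact hcH.mul hA
    · simp [Derivation.leibniz, Derivation.leibniz_pow, hs2, hδc]
    · have h2 : i + (N * j1 + j) = N * j1 + i + j := by ring
      rw [h2]; exact hαH
    · have h1 : c * ((N.factorial : MvPolynomial (Fin 3) k) * (D f) ^ N) * e - α
          = (c * ((N.factorial : MvPolynomial (Fin 3) k) * (D f) ^ N * e - (⇑D)^[N] e * f ^ N) - α)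
          + (c * (⇑D)^[N] e) * f ^ N := by ring
      rw [h1]
      exact dvd_add hce (Dvd.dvd.mul_left (dvd_pow_self _ hN0) _)


theorem uniq_pts {k : Type} [Field k] [IsAlgClosed k] [CharZero k] {q : MvPolynomial (Fin 3) k}
    {dq : ℕ} (hq : q.IsWeightedHomogeneous w3 dq) (hqi : Irreducible q)
    (D : Derivation k (MvPolynomial (Fin 3) k) (MvPolynomial (Fin 3) k))
    (hlnd : IsLND D) (hirr : IsIrreducibleDeriv D) {m : ℤ} (hhom : DerivIsHomogOfDeg w3 D m)
    (hDq : D q = 0) {u : MvPolynomial (Fin 3) k} {n : ℕ} (hn : n ≠ 0)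
    (hu : u.IsWeightedHomogeneous w3 n) (hqu : ¬ q ∣ u) (hDu : D u = 0)
    (P P' : Ideal (MvPolynomial (Fin 3) k)) [P.IsPrime] [P'.IsPrime]
    (hqP : q ∈ P) (hqP' : q ∈ P') (huP : u ∈ P) (huP' : u ∈ P')
    (hX : ∃ i, X i ∉ P') {r : MvPolynomial (Fin 3) k} {i : ℕ} (hr : r.IsWeightedHomogeneous w3 i)
    (hrP' : r ∈ P') : r ∈ P := by
  have hprime : (Ideal.span {q}).IsPrime := (Ideal.span_singleton_prime hqi.ne_zero).2 hqi.prime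
  have hdom : IsDomain (MvPolynomial (Fin 3) k ⧸ Ideal.span {q}) := Ideal.Quotient.isDomain _
  by_cases hi : i = 0
  · subst hi
    rw [wh_zero_const hr] at hrP' ⊢
    by_cases hc : coeff 0 r = 0
    · rw [hc, map_zero]; exact P.zero_mem
    · exfalso
      exact Ideal.IsPrime.ne_top ‹P'.IsPrime› (Ideal.eq_top_of_isUnit_mem _ hrP' ((IsUnit.mk0 _ hc).map C))
  obtain ⟨δ, hδ, S, s, ds, hs, hs1, hs2⟩ := quot_setup hq hqi D hlnd hirr hhom hDq
  obtain ⟨i0, hi0⟩ := hX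
  have key : ∀ (Q : Ideal (MvPolynomial (Fin 3) k)), q ∈ Q → ∀ x, 
      Ideal.Quotient.mk (Ideal.span {q}) x ∈ Q.map (Ideal.Quotient.mk (Ideal.span {q})) ↔ x ∈ Q := by
    intro Q hQ x
    rw [← Ideal.mem_comap, Ideal.comap_map_of_surjective _ Ideal.Quotient.mk_surjective]
    have : Ideal.comap (Ideal.Quotient.mk (Ideal.span {q})) ⊥ = Ideal.span {q} := Ideal.mk_ker
    rw [this, sup_eq_left.2 ((Ideal.span_singleton_le_iff_mem _).2 hQ)]
  have hpr : ∀ (Q : Ideal (MvPolynomial (Fin 3) k)), q ∈ Q → Q.IsPrime → 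
      (Q.map (Ideal.Quotient.mk (Ideal.span {q}))).IsPrime := by
    intro Q hQ hp
    refine Ideal.map_isPrime_of_surjective Ideal.Quotient.mk_surjective ?_
    rw [Ideal.mk_ker]; exact (Ideal.span_singleton_le_iff_mem _).2 hQ
  have hp1 := hpr P hqP ‹_›
  have hp2 := hpr P' hqP' ‹_›
  rw [← key P hqP]
  refine uniq_core S (u := Ideal.Quotient.mk _ u) hn (mem_qH.2 ⟨u, hu, rfl⟩) ?_ ?_ hs hs1 hs2 _ 
    (P'.map (Ideal.Quotient.mk (Ideal.span {q}))) ((key P hqP u).2 huP) ((key P' hqP' u).2 huP') hi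
    (j := w3 i0) ?_ (mem_qH.2 ⟨r, hr, rfl⟩) (mem_qH.2 ⟨X i0, isWeightedHomogeneous_X _ _ _, rfl⟩) ?_ 
    ((key P' hqP' r).2 hrP')
  · rw [Ne, Ideal.Quotient.eq_zero_iff_mem, Ideal.mem_span_singleton]; exact hqu
  · rw [hδ, hDu, map_zero]
  · fin_cases i0 <;> simp [w3]
  · rw [key P' hqP']; exact hi0

theorem grading_eq {k : Type} [Field k] {f : MvPolynomial (Fin 3) k}
    (ℬ : ℕ → Submodule k (MvPolynomial (Fin 3) k ⧸ Ideal.span {f}))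
    [GradedAlgebra ℬ]
    (h : ∀ (i : ℕ) (r : MvPolynomial (Fin 3) k), r.IsWeightedHomogeneous w3 i →
      Ideal.Quotient.mk (Ideal.span {f}) r ∈ ℬ i) : ℬ = qH k f := by
  classical
  funext i
  apply le_antisymm
  · intro x hx
    obtain ⟨r, rfl⟩ := Ideal.Quotient.mk_surjective x
    refine mem_qH.2 ⟨weightedHomogeneousComponent w3 i r, weightedHomogeneousComponent_isWeightedHomogeneous _ _, ?_⟩
    have key : ∀ r : MvPolynomial (Fin 3) k, ∀ i, (DirectSum.decompose ℬ (Ideal.Quotient.mk (Ideal.span {f}) r) i : 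
        MvPolynomial (Fin 3) k ⧸ Ideal.span {f}) = 
        Ideal.Quotient.mk (Ideal.span {f}) (weightedHomogeneousComponent w3 i r) := by
      intro r i
      induction r using MvPolynomial.induction_on' with
      | monomial d c =>
        have hm : (monomial d c : MvPolynomial (Fin 3) k).IsWeightedHomogeneous w3 (Finsupp.weight w3 d) :=
          isWeightedHomogeneous_monomial _ _ _ rfl
        by_cases hi : Finsupp.weight w3 d = i
        · rw [hi] at hm
          rw [hm.weightedHomogeneousComponent_same, DirectSum.decompose_of_mem_same _ (h i _ hm)]
        · rw [hm.weightedHomogeneousComponent_ne _ (Ne.symm hi), DirectSum.decompose_of_mem_ne _ (h _ _ hm) hi, map_zero]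
      | add p q hp hq =>
        rw [map_add, DirectSum.decompose_add, DirectSum.add_apply, Submodule.coe_add, hp, hq, map_add, map_add]
    rw [← key, DirectSum.decompose_of_mem_same _ hx]
  · intro x hx
    obtain ⟨r, hr, rfl⟩ := mem_qH.1 hx
    exact h i r hr

theorem pt_X {k : Type} [Field k] {f : MvPolynomial (Fin 3) k} [GradedAlgebra (qH k f)]
    (P : AlgebraicGeometry.Proj (qH k f)) : 
    ∃ i, X i ∉ P.asHomogeneousIdeal.toIdeal.comap (Ideal.Quotient.mk (Ideal.span {f})) := by
  classical
  by_contra! hc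
  apply P.not_irrelevant_le
  intro x hx
  rw [HomogeneousIdeal.mem_irrelevant_iff, GradedRing.proj_apply] at hx
  change x ∈ P.asHomogeneousIdeal.toIdeal
  rw [← DirectSum.sum_support_decompose (qH k f) x]
  apply Ideal.sum_mem
  intro i _
  by_cases hi : i = 0
  · subst hi; rw [hx]; exact Ideal.zero_mem _
  obtain ⟨r, hr, hrx⟩ := mem_qH.1 (DirectSum.decompose (qH k f) x i).2
  rw [← hrx, ← Ideal.mem_comap]
  have h1 : r ∈ Ideal.span ((X : Fin 3 → MvPolynomial (Fin 3) k) '' Set.univ) := by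
    rw [MvPolynomial.mem_ideal_span_X_image]
    intro t ht
    by_contra! h0
    have : t = 0 := by ext i; exact h0 i (Set.mem_univ _)
    have h2 := hr (mem_support_iff.1 ht)
    rw [this, map_zero] at h2
    exact hi h2.symm
  refine (Ideal.span_le.2 ?_) h1
  rintro _ ⟨i, -, rfl⟩
  exact hc i

theorem pt_ext {k : Type} [Field k] {f : MvPolynomial (Fin 3) k} [GradedAlgebra (qH k f)]
    (P P' : AlgebraicGeometry.Proj (qH k f)) 
    (h : ∀ (r : MvPolynomial (Fin 3) k) i, r.IsWeightedHomogeneous w3 i →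
      (r ∈ P.asHomogeneousIdeal.toIdeal.comap (Ideal.Quotient.mk (Ideal.span {f})) ↔
       r ∈ P'.asHomogeneousIdeal.toIdeal.comap (Ideal.Quotient.mk (Ideal.span {f})))) : P = P' := by
  classical
  have aux : ∀ P P' : AlgebraicGeometry.Proj (qH k f), (∀ (r : MvPolynomial (Fin 3) k) i, r.IsWeightedHomogeneous w3 i →
      (r ∈ P.asHomogeneousIdeal.toIdeal.comap (Ideal.Quotient.mk (Ideal.span {f})) →
       r ∈ P'.asHomogeneousIdeal.toIdeal.comap (Ideal.Quotient.mk (Ideal.span {f})))) → 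
       P.asHomogeneousIdeal.toIdeal ≤ P'.asHomogeneousIdeal.toIdeal := by
    intro P P' h x hx
    rw [← DirectSum.sum_support_decompose (qH k f) x]
    apply Ideal.sum_mem
    intro i _
    have h1 := P.asHomogeneousIdeal.isHomogeneous i hx
    obtain ⟨r, hr, hrx⟩ := mem_qH.1 (DirectSum.decompose (qH k f) x i).2
    rw [← hrx, ← Ideal.mem_comap]
    apply h r i hr
    rw [Ideal.mem_comap, hrx]
    exact h1
  apply ProjectiveSpectrum.ext
  apply HomogeneousIdeal.toIdeal_injective
  exact le_antisymm (aux P P' fun r i hr => (h r i hr).1) (aux P' P fun r i hr => (h r i hr).2)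


theorem reg1 {k : Type} [Field k] [IsAlgClosed k] [CharZero k] {f : MvPolynomial (Fin 3) k}
    {dq : ℕ} (hf : f.IsWeightedHomogeneous w3 dq) (hfi : Irreducible f)
    (D : Derivation k (MvPolynomial (Fin 3) k) (MvPolynomial (Fin 3) k))
    (hlnd : IsLND D) (hirr : IsIrreducibleDeriv D) {m : ℤ} (hhom : DerivIsHomogOfDeg w3 D m)
    (hDf : D f = 0) {u : MvPolynomial (Fin 3) k} {n : ℕ} (hn : n ≠ 0)
    (hu : u.IsWeightedHomogeneous w3 n) (hDu : D u = 0) [GradedAlgebra (qH k f)]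
    (P : AlgebraicGeometry.Proj (qH k f))
    (huP : u ∉ P.asHomogeneousIdeal.toIdeal.comap (Ideal.Quotient.mk (Ideal.span {f}))) :
    IsRegLocalRing ((AlgebraicGeometry.Proj (qH k f)).presheaf.stalk P) := by
  have hprime : (Ideal.span {f}).IsPrime := (Ideal.span_singleton_prime hfi.ne_zero).2 hfi.prime
  have hdom : IsDomain (MvPolynomial (Fin 3) k ⧸ Ideal.span {f}) := Ideal.Quotient.isDomain _
  obtain ⟨δ, hδ, S, s, ds, hs, hs1, hs2⟩ := quot_setup hf hfi D hlnd hirr hhom hDf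
  refine proj_reg k (qH k f) P (fun l => {a | a ∈ qH k f l ∧ δ a = 0}) (fun l a ha => ha.1)
    ⟨S.one, by simp⟩ ?_ ?_ (u := Ideal.Quotient.mk _ u) hn ⟨mem_qH.2 ⟨u, hu, rfl⟩, by rw [hδ, hDu, map_zero]⟩ huP hs ?_ ?_
  · intro i j a b ha hb
    refine ⟨S.mul ha.1 hb.1, ?_⟩
    rw [Derivation.leibniz, ha.2, hb.2, smul_zero, smul_zero, add_zero]
  · intro i a b ha hb hb0
    exact S.prop i a b ha.1 hb.1 ha.2 hb.2 hb0
  · intro h; rw [h, map_zero] at hs1; exact hs1 rfl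
  · intro i e he
    obtain ⟨N, hN⟩ := S.lnd e
    obtain ⟨j, c, hc0, hcH, hδc, hce⟩ := frac1 S hs hs1 hs2 N i e he hN
    exact ⟨j, c, hc0, Submodule.subset_span ⟨c, j, 0, ⟨hcH, hδc⟩, by simp, by simp⟩, hce⟩

theorem reg2 {k : Type} [Field k] [IsAlgClosed k] [CharZero k] {f : MvPolynomial (Fin 3) k}
    {dq : ℕ} (hf : f.IsWeightedHomogeneous w3 dq) (hfi : Irreducible f)
    (D : Derivation k (MvPolynomial (Fin 3) k) (MvPolynomial (Fin 3) k))
    (hlnd : IsLND D) {m : ℤ} (hhom : DerivIsHomogOfDeg w3 D m)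
    (hDf : D f ≠ 0) (hD2f : D (D f) = 0) {g h : MvPolynomial (Fin 3) k} {d e : ℕ} (hd : d ≠ 0)
    (hg : g.IsWeightedHomogeneous w3 d) (hh : h.IsWeightedHomogeneous w3 e)
    (hh0 : h ≠ 0) (hDh : D h = 0) 
    (hker : ∀ r, D r = 0 → r ∈ Algebra.adjoin k ({g, h} : Set (MvPolynomial (Fin 3) k)))
    [GradedAlgebra (qH k f)]
    (P : AlgebraicGeometry.Proj (qH k f))
    (huP : g ∉ P.asHomogeneousIdeal.toIdeal.comap (Ideal.Quotient.mk (Ideal.span {f}))) :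
    IsRegLocalRing ((AlgebraicGeometry.Proj (qH k f)).presheaf.stalk P) := by
  have hprime : (Ideal.span {f}).IsPrime := (Ideal.span_singleton_prime hfi.ne_zero).2 hfi.prime
  have hdom : IsDomain (MvPolynomial (Fin 3) k ⧸ Ideal.span {f}) := Ideal.Quotient.isDomain _
  let mk := Ideal.Quotient.mk (Ideal.span {f})
  have hspan : ∀ (α : MvPolynomial (Fin 3) k) i, D α = 0 → α.IsWeightedHomogeneous w3 i → 
      mk α ∈ grS k (fun l => {a | ∃ (c : k) (n : ℕ), n * d = l ∧ a = c • mk g ^ n}) (mk h) e i := by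
    intro α i hα hαi
    have h1 := ker_hom_span hg hh hαi (hker α hα)
    have h2 := Submodule.mem_map_of_mem (f := (Ideal.Quotient.mkₐ k (Ideal.span {f})).toLinearMap) h1
    rw [Submodule.map_span] at h2
    refine Submodule.span_mono ?_ h2
    rintro _ ⟨_, ⟨a, b, hab, rfl⟩, rfl⟩
    refine ⟨mk g ^ a, a * d, b, ⟨1, a, rfl, by rw [one_smul]⟩, hab, ?_⟩
    change mk (g ^ a * h ^ b) = _
    rw [map_mul, map_pow, map_pow]
  refine proj_reg k (qH k f) P (fun l => {a | ∃ (c : k) (n : ℕ), n * d = l ∧ a = c • mk g ^ n}) ?_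
    ⟨1, 0, by simp, by simp⟩ ?_ ?_ (u := mk g) hd ⟨1, 1, by simp, by simp⟩ huP (s := mk h) (ds := e)
    (mem_qH.2 ⟨h, hh, rfl⟩) ?_ ?_
  · rintro l a ⟨c, n, rfl, rfl⟩
    apply Submodule.smul_mem
    exact mem_qH.2 ⟨g ^ n, by simpa using hg.pow n, map_pow _ _ _⟩
  · rintro i j a b ⟨c, n, rfl, rfl⟩ ⟨c', n', rfl, rfl⟩
    exact ⟨c * c', n + n', by ring, by rw [pow_add, smul_mul_smul_comm]⟩
  · rintro i a b ⟨c, n, rfl, rfl⟩ ⟨c', n', hnn, rfl⟩ hb0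
    have : n' = n := Nat.eq_of_mul_eq_mul_right (Nat.pos_of_ne_zero hd) hnn
    subst this
    have hc' : c' ≠ 0 := by rintro rfl; simp at hb0
    exact ⟨c / c', by rw [smul_smul, div_mul_cancel₀ _ hc']⟩
  · intro h0
    rw [Ideal.Quotient.eq_zero_iff_mem, Ideal.mem_span_singleton] at h0
    obtain ⟨c, rfl⟩ := h0
    exact hDf (lnd_fact_closed D hlnd hh0 hDh)
  · intro i e' he'
    obtain ⟨r, hr, rfl⟩ := mem_qH.1 he'
    obtain ⟨N, hN⟩ := hlnd r
    obtain ⟨j, c, α, hc0, hcH, hDc, hDα, hαH, hce⟩ := frac2 D hlnd hhom hf hfi.prime hDf hD2f N i r hr hN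
    refine ⟨j, mk c, ?_, hspan c j hDc hcH, ?_⟩
    · rw [Ne, Ideal.Quotient.eq_zero_iff_mem, Ideal.mem_span_singleton]; exact hc0
    · have h1 : mk c * mk r = mk α := by
        rw [← map_mul, Ideal.Quotient.eq, Ideal.mem_span_singleton]; exact hce
      have h2 := hspan α (i + j) hDα hαH
      rw [← h1] at h2
      exact h2

theorem main_false (k : Type) [Field k] [IsAlgClosed k] [CharZero k]
    (f : MvPolynomial (Fin 3) k)
    (hf9 : f.IsWeightedHomogeneous w3 9)
    (hC1 : Irreducible f)
    (hC2 : CondC2 k f)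
    (D : Derivation k (MvPolynomial (Fin 3) k) (MvPolynomial (Fin 3) k))
    (hlnd : IsLND D) (hirr : IsIrreducibleDeriv D)
    (hhom : ∃ m : ℤ, DerivIsHomogOfDeg w3 D m)
    (hD2f : D (D f) = 0)
    (g h : MvPolynomial (Fin 3) k) (d e : ℕ)
    (hg : g.IsWeightedHomogeneous w3 d) (hh : h.IsWeightedHomogeneous w3 e)
    (hker : ∀ r : MvPolynomial (Fin 3) k,
      D r = 0 ↔ r ∈ Algebra.adjoin k ({g, h} : Set (MvPolynomial (Fin 3) k))) : False := by
  obtain ⟨m, hm⟩ := hhom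
  obtain ⟨ℬ, inst, hℬ, x, y, hxy, hx, hy⟩ := hC2
  obtain rfl := grading_eq ℬ hℬ
  have hDg : D g = 0 := (hker g).2 (Algebra.subset_adjoin (by simp))
  have hDh : D h = 0 := (hker h).2 (Algebra.subset_adjoin (by simp))
  have hker1 : ∀ r, D r = 0 → r ∈ Algebra.adjoin k ({g, h} : Set (MvPolynomial (Fin 3) k)) := 
    fun r hr => (hker r).1 hr
  have hker2 : ∀ r, D r = 0 → r ∈ Algebra.adjoin k ({h, g} : Set (MvPolynomial (Fin 3) k)) := 
    fun r hr => by rw [Set.pair_comm]; exact (hker r).1 hr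
  obtain ⟨i0, hi0⟩ := exists_X_not_mem (q := (0 : MvPolynomial (Fin 3) k)) not_isUnit_zero D hirr
  have hi0' : D (X i0) ≠ 0 := by
    intro h0; rw [h0] at hi0; exact hi0 (Ideal.zero_mem _)
  obtain ⟨N, hs1, hs2⟩ := exists_slice D hlnd hi0'
  have hind := gh_indep D hlnd hs1 hs2 g h hker1
  have hind1 : AlgebraicIndependent k ![g, h] := by
    have := hind.comp (![0, 1] : Fin 2 → Fin 3) (by decide)
    convert this using 1
    ext i; fin_cases i <;> rfl
  have hind2 : AlgebraicIndependent k ![h, g] := by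
    have := hind.comp (![1, 0] : Fin 2 → Fin 3) (by decide)
    convert this using 1
    ext i; fin_cases i <;> rfl
  obtain ⟨hgi, hgh, hgc⟩ := gen_irr D hlnd hind1 hker1 hDg hDh
  obtain ⟨hhi, hhg, hhc⟩ := gen_irr D hlnd hind2 hker2 hDh hDg
  have hd : d ≠ 0 := by rintro rfl; exact hgc _ (wh_zero_const hg)
  have he : e ≠ 0 := by rintro rfl; exact hhc _ (wh_zero_const hh)
  have hpx := x.isPrime
  have hpy := y.isPrime
  have hfP : ∀ P : AlgebraicGeometry.Proj (qH k f), 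
      f ∈ P.asHomogeneousIdeal.toIdeal.comap (Ideal.Quotient.mk (Ideal.span {f})) := by
    intro P
    rw [Ideal.mem_comap, Ideal.Quotient.eq_zero_iff_mem.2 (Ideal.mem_span_singleton_self f)]
    exact Ideal.zero_mem _
  -- conclusion from a pair `q, u`
  have fin : ∀ (q u : MvPolynomial (Fin 3) k) (dq n : ℕ), q.IsWeightedHomogeneous w3 dq → Irreducible q → 
      D q = 0 → n ≠ 0 → u.IsWeightedHomogeneous w3 n → ¬ q ∣ u → D u = 0 →
      (∀ P : AlgebraicGeometry.Proj (qH k f), 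
        ¬ IsRegLocalRing ((AlgebraicGeometry.Proj (qH k f)).presheaf.stalk P) → 
        q ∈ P.asHomogeneousIdeal.toIdeal.comap (Ideal.Quotient.mk (Ideal.span {f})) ∧
        u ∈ P.asHomogeneousIdeal.toIdeal.comap (Ideal.Quotient.mk (Ideal.span {f}))) → False := by
    intro q u dq n hq hqi hDq hn hu hqu hDu hP
    apply hxy
    apply pt_ext
    intro r i hr
    exact ⟨fun h => uniq_pts hq hqi D hlnd hirr hm hDq hn hu hqu hDu _ _ (hP y hy).1 (hP x hx).1 (hP y hy).2
      (hP x hx).2 (pt_X x) hr h,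
      fun h => uniq_pts hq hqi D hlnd hirr hm hDq hn hu hqu hDu _ _ (hP x hx).1 (hP y hy).1 (hP x hx).2
      (hP y hy).2 (pt_X y) hr h⟩
  by_cases hDf : D f = 0
  · have : ∃ u n, n ≠ 0 ∧ u.IsWeightedHomogeneous w3 n ∧ ¬ f ∣ u ∧ D u = 0 := by
      by_cases hfg : f ∣ g
      · refine ⟨h, e, he, hh, ?_, hDh⟩
        intro hfh
        exact hgh (((hC1.associated_of_dvd hgi hfg).symm.dvd).trans hfh)
      · exact ⟨g, d, hd, hg, hfg, hDg⟩
    obtain ⟨u, n, hn, hu, hfu, hDu⟩ := this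
    refine fin f u 9 n hf9 hC1 hDf hn hu hfu hDu fun P hP => ⟨hfP P, ?_⟩
    by_contra hc
    exact hP (reg1 hf9 hC1 D hlnd hirr hm hDf hn hu hDu P hc)
  · refine fin g h d e hg hgi hDg he hh hgh hDh fun P hP => ⟨?_, ?_⟩
    · by_contra hc
      exact hP (reg2 hf9 hC1 D hlnd hm hDf hD2f hd hg hh hhi.ne_zero hDh hker1 P hc)
    · by_contra hc
      exact hP (reg2 hf9 hC1 D hlnd hm hDf hD2f he hh hg hgi.ne_zero hDg hker2 P hc)

/-- Lemma 3.3 (lemma3): under Setup 3.1 (`f ∈ R₉` satisfies (C1)-(C3), `D` is an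
irreducible homogeneous locally nilpotent derivation with `D²f = 0`, and
`ker D = k[g,h]` with `g, h` homogeneous of degrees `d ≤ e`):
(a) every homogeneous minimal local slice `r` of `D` satisfies `Dr ∈ k[g]`, and
`f = s·h·r + t·g³` for some `s, t ∈ k*`;
(b) `(d, e) ∈ {(3,5), (3,7)}`. -/
theorem statement_16 (k : Type) [Field k] [IsAlgClosed k] [CharZero k]
    (f : MvPolynomial (Fin 3) k)
    (hf9 : f.IsWeightedHomogeneous w3 9)
    (hC1 : Irreducible f)
    (hC2 : CondC2 k f)
    (hC3 : CondC3 k f)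
    (D : Derivation k (MvPolynomial (Fin 3) k) (MvPolynomial (Fin 3) k))
    (hlnd : IsLND D) (hirr : IsIrreducibleDeriv D)
    (hhom : ∃ m : ℤ, DerivIsHomogOfDeg w3 D m)
    (hD2f : D (D f) = 0)
    (g h : MvPolynomial (Fin 3) k) (d e : ℕ)
    (hg : g.IsWeightedHomogeneous w3 d) (hh : h.IsWeightedHomogeneous w3 e)
    (hde : d ≤ e)
    (hker : ∀ r : MvPolynomial (Fin 3) k,
      D r = 0 ↔ r ∈ Algebra.adjoin k ({g, h} : Set (MvPolynomial (Fin 3) k))) :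
    (∀ r : MvPolynomial (Fin 3) k, (∃ dr : ℕ, r.IsWeightedHomogeneous w3 dr) →
      IsMinimalLocalSlice D r →
      D r ∈ Algebra.adjoin k ({g} : Set (MvPolynomial (Fin 3) k)) ∧
      ∃ s t : k, s ≠ 0 ∧ t ≠ 0 ∧ f = C s * h * r + C t * g ^ 3) ∧
    ((d = 3 ∧ e = 5) ∨ (d = 3 ∧ e = 7)) := by
  exact (main_false k f hf9 hC1 hC2 D hlnd hirr hhom hD2f g h d e hg hh hker).elim
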